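/- Let B and C be Gorenstein finite-dimensional algebras over a field k and M a C-B-bimodule such that the triangular matrix algebra A = [[B,0],[M,C]] is Gorenstein. Then the triangle functor i^! = RHom_A((B,0)_A, −): D(Mod A) → D(Mod B) preserves compact objects; i.e., it sends K^b(proj A) into K^b(proj B). -/

import Mathlib

/-!
STATEMENT 2: Let B and C be Gorenstein finite-dimensional algebras over a field k and M a
C-B-bimodule such that the triangular matrix algebra A = [[B,0],[M,C]] is Gorenstein. Then
the triangle functor i^! = RHom_A((B,0)_A, −): D(Mod A) → D(Mod B) preserves compact
objects; i.e., it sends K^b(proj A) into K^b(proj B).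
-/
set_option linter.unusedSectionVars false in
/-- The triangular matrix algebra `A = [[B, 0], [M, C]]` attached to a `C`-`B`-bimodule `M`:
elements are triples `(b, m, c)`, thought of as matrices `(b 0; m c)`. -/
@[ext] structure TriMat (B C M : Type*) where
  fst : B
  mid : M
  snd : C

namespace TriMat

set_option linter.unusedSectionVars false
set_option linter.unnecessarySeqFocus false

variable {B C M : Type*} [Ring B] [Ring C] [AddCommGroup M]
  [Module C M] [Module Bᵐᵒᵖ M] [SMulCommClass C Bᵐᵒᵖ M]

instance : Add (TriMat B C M) := ⟨fun x y => ⟨x.fst + y.fst, x.mid + y.mid, x.snd + y.snd⟩⟩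
instance : Zero (TriMat B C M) := ⟨⟨0, 0, 0⟩⟩
instance : Neg (TriMat B C M) := ⟨fun x => ⟨-x.fst, -x.mid, -x.snd⟩⟩

@[simp] lemma add_fst (x y : TriMat B C M) : (x + y).fst = x.fst + y.fst := rfl
@[simp] lemma add_mid (x y : TriMat B C M) : (x + y).mid = x.mid + y.mid := rfl
@[simp] lemma add_snd (x y : TriMat B C M) : (x + y).snd = x.snd + y.snd := rfl
@[simp] lemma zero_fst : (0 : TriMat B C M).fst = 0 := rfl
@[simp] lemma zero_mid : (0 : TriMat B C M).mid = 0 := rfl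
@[simp] lemma zero_snd : (0 : TriMat B C M).snd = 0 := rfl
@[simp] lemma neg_fst (x : TriMat B C M) : (-x).fst = -x.fst := rfl
@[simp] lemma neg_mid (x : TriMat B C M) : (-x).mid = -x.mid := rfl
@[simp] lemma neg_snd (x : TriMat B C M) : (-x).snd = -x.snd := rfl

instance instAddCommGroup : AddCommGroup (TriMat B C M) where
  add_assoc x y z := by ext <;> simp [add_assoc]
  zero_add x := by ext <;> simp
  add_zero x := by ext <;> simp
  neg_add_cancel x := by ext <;> simp
  add_comm x y := by ext <;> simp [add_comm]
  nsmul := nsmulRec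
  zsmul := zsmulRec

/-- Multiplication of triangular matrices:
`(b, m, c) * (b', m', c') = (b b', m ⋅ b' + c ⋅ m', c c')`. -/
instance : Mul (TriMat B C M) :=
  ⟨fun x y => ⟨x.fst * y.fst, MulOpposite.op y.fst • x.mid + x.snd • y.mid, x.snd * y.snd⟩⟩
instance : One (TriMat B C M) := ⟨⟨1, 0, 1⟩⟩

@[simp] lemma mul_fst (x y : TriMat B C M) : (x * y).fst = x.fst * y.fst := rfl
@[simp] lemma mul_mid (x y : TriMat B C M) :
    (x * y).mid = MulOpposite.op y.fst • x.mid + x.snd • y.mid := rfl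
@[simp] lemma mul_snd (x y : TriMat B C M) : (x * y).snd = x.snd * y.snd := rfl
@[simp] lemma one_fst : (1 : TriMat B C M).fst = 1 := rfl
@[simp] lemma one_mid : (1 : TriMat B C M).mid = 0 := rfl
@[simp] lemma one_snd : (1 : TriMat B C M).snd = 1 := rfl

instance instRing : Ring (TriMat B C M) :=
  { instAddCommGroup (B := B) (C := C) (M := M),
    (inferInstance : Mul (TriMat B C M)), (inferInstance : One (TriMat B C M)) with
    left_distrib := fun x y z => by
      ext <;> simp [mul_add, smul_add, MulOpposite.op_add, add_smul] <;> abel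
    right_distrib := fun x y z => by
      ext <;> simp [add_mul, MulOpposite.op_add, add_smul] <;> abel
    zero_mul := fun x => by ext <;> simp
    mul_zero := fun x => by ext <;> simp
    mul_assoc := fun x y z => by
      ext
      · simp [mul_assoc]
      · simp only [mul_mid, mul_fst, mul_snd, smul_add, add_assoc, MulOpposite.op_mul, mul_smul]
        rw [smul_comm x.snd (MulOpposite.op z.fst) y.mid]
      · simp [mul_assoc]
    one_mul := fun x => by ext <;> simp
    mul_one := fun x => by ext <;> simp }

variable (B C M)
variable (k : Type*) [CommSemiring k] [Algebra k B] [Algebra k C]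
  [Module k M] [IsScalarTower k C M] [IsScalarTower k Bᵐᵒᵖ M]

/-- The canonical (diagonal) ring homomorphism `k → TriMat B C M`. -/
def algMap : k →+* TriMat B C M where
  toFun a := ⟨algebraMap k B a, 0, algebraMap k C a⟩
  map_one' := by ext <;> simp
  map_mul' a b := by ext <;> simp
  map_zero' := by ext <;> simp
  map_add' a b := by ext <;> simp

instance instAlgebra : Algebra k (TriMat B C M) :=
  RingHom.toAlgebra' (algMap B C M k) (by
    intro a x
    ext
    · simp [algMap, Algebra.commutes]
    · show MulOpposite.op x.fst • (0 : M) + algebraMap k C a • x.mid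
        = MulOpposite.op (algebraMap k B a) • x.mid + x.snd • (0 : M)
      rw [smul_zero, smul_zero, add_zero, zero_add, algebraMap_smul,
        ← MulOpposite.algebraMap_apply, algebraMap_smul]
    · simp [algMap, Algebra.commutes])

end TriMat
open CategoryTheory CategoryTheory.Limits

/-- A module `N` over `R` has injective dimension at most `n`: the Ext groups
`Ext^i(M, N)` vanish for all modules `M` and all `i > n`. -/
def InjDimLE (R : Type) [Ring R] (N : ModuleCat.{0} R) (n : ℕ) : Prop :=
  ∀ (M : ModuleCat.{0} R) (i : ℕ), n < i →
    IsZero (((Ext ℤ (ModuleCat.{0} R) i).obj (Opposite.op M)).obj N)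

/-- A module has finite injective dimension. -/
def HasFiniteInjDim (R : Type) [Ring R] (N : ModuleCat.{0} R) : Prop :=
  ∃ n : ℕ, InjDimLE R N n

/-- An algebra `Λ` is Gorenstein if it has finite injective dimension as a left
`Λ`-module and as a right `Λ`-module. -/
def IsGorenstein (Λ : Type) [Ring Λ] : Prop :=
  HasFiniteInjDim Λ (ModuleCat.of Λ Λ) ∧ HasFiniteInjDim Λᵐᵒᵖ (ModuleCat.of Λᵐᵒᵖ Λ)
open CategoryTheory CategoryTheory.Limits CategoryTheory.Pretriangulated

section TriangulatedPreliminaries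

universe v v' v'' u u' u''

variable {C : Type u} {C' : Type u'} {C'' : Type u''}
  [Category.{v} C] [Category.{v'} C'] [Category.{v''} C'']
  [HasShift C ℤ] [HasShift C' ℤ] [HasShift C'' ℤ]
  [Preadditive C] [Preadditive C'] [Preadditive C'']
  [HasZeroObject C] [HasZeroObject C'] [HasZeroObject C'']
  [∀ n : ℤ, (shiftFunctor C n).Additive] [∀ n : ℤ, (shiftFunctor C' n).Additive]
  [∀ n : ℤ, (shiftFunctor C'' n).Additive]
  [Pretriangulated C] [Pretriangulated C'] [Pretriangulated C'']

/-- A functor between pretriangulated categories is a triangle functor if it admits a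
commutation structure with the shifts for which it preserves distinguished triangles. -/
def IsTriangleFunctor (F : C ⥤ C') : Prop :=
  ∃ c : F.CommShift ℤ, @Functor.IsTriangulated _ _ _ _ _ _ F c _ _ _ _ _ _ _ _

/-- The kernel of a functor: the class of objects sent to a zero object. -/
def kerSet (F : C ⥤ C') : Set C := { X | IsZero (F.obj X) }

/-- A left recollement `(𝒞', 𝒞, 𝒞'', i^*, i_*, j_!, j^*)`: there are adjoint pairs
`(i^*, i_*)` and `(j_!, j^*)`, the functors `i_*`, `j_!` are fully faithful, `j^* i_* = 0`,
and every object `X` fits in a distinguished triangle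
`j_! j^* X ⟶ X ⟶ i_* i^* X ⟶ (j_! j^* X)[1]` whose morphisms into and out of `X` are the
counit and the unit of the adjunctions. -/
def IsLeftRecollement (iStar : C ⥤ C') (iPush : C' ⥤ C)
    (jShriek : C'' ⥤ C) (jStar : C ⥤ C'') : Prop :=
  ∃ (adjI : iStar ⊣ iPush) (adjJ : jShriek ⊣ jStar),
    iPush.Full ∧ iPush.Faithful ∧ jShriek.Full ∧ jShriek.Faithful ∧
    (∀ X' : C', IsZero (jStar.obj (iPush.obj X'))) ∧
    (∀ X : C, ∃ h : iPush.obj (iStar.obj X) ⟶ (jShriek.obj (jStar.obj X))⟦(1 : ℤ)⟧,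
      Triangle.mk (adjJ.counit.app X) (adjI.unit.app X) h ∈ distTriang C)

/-- A recollement `(𝒞', 𝒞, 𝒞'', i^*, i_*, i^!, j_!, j^*, j_*)`, i.e. the data of
conditions (R1)-(R4): adjoint pairs `(i^*, i_*)`, `(i_*, i^!)`, `(j_!, j^*)`, `(j^*, j_*)`;
`i_*`, `j_!`, `j_*` fully faithful; `j^* i_* = 0`; and the two recollement distinguished
triangles `j_! j^* X ⟶ X ⟶ i_* i^* X ⟶ ⋅[1]` and `i_* i^! X ⟶ X ⟶ j_* j^* X ⟶ ⋅[1]`, whose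
morphisms into and out of `X` are counits and units of the adjunctions. -/
def IsRecollement (iStar : C ⥤ C') (iPush : C' ⥤ C) (iShriek : C ⥤ C')
    (jShriek : C'' ⥤ C) (jStar : C ⥤ C'') (jPush : C'' ⥤ C) : Prop :=
  ∃ (adjI₁ : iStar ⊣ iPush) (adjI₂ : iPush ⊣ iShriek)
    (adjJ₁ : jShriek ⊣ jStar) (adjJ₂ : jStar ⊣ jPush),
    iPush.Full ∧ iPush.Faithful ∧ jShriek.Full ∧ jShriek.Faithful ∧
    jPush.Full ∧ jPush.Faithful ∧
    (∀ X' : C', IsZero (jStar.obj (iPush.obj X'))) ∧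
    (∀ X : C, ∃ h : iPush.obj (iStar.obj X) ⟶ (jShriek.obj (jStar.obj X))⟦(1 : ℤ)⟧,
      Triangle.mk (adjJ₁.counit.app X) (adjI₁.unit.app X) h ∈ distTriang C) ∧
    (∀ X : C, ∃ h : jPush.obj (jStar.obj X) ⟶ (iPush.obj (iShriek.obj X))⟦(1 : ℤ)⟧,
      Triangle.mk (adjI₂.counit.app X) (adjJ₂.unit.app X) h ∈ distTriang C)

/-- An unbounded ladder of triangle functors, encoded by the four families
`a n = i_{2n} : 𝒞' ⥤ 𝒞`, `b n = i_{2n-1} : 𝒞'' ⥤ 𝒞`, `p n = j_{2n-1} : 𝒞 ⥤ 𝒞'` and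
`q n = j_{2n} : 𝒞 ⥤ 𝒞''` (`n ∈ ℤ`): any two consecutive rows form a left or a right
recollement of `𝒞` relative to `𝒞'` and `𝒞''`. -/
structure IsUnboundedLadder (a : ℤ → C' ⥤ C) (b : ℤ → C'' ⥤ C)
    (p : ℤ → C ⥤ C') (q : ℤ → C ⥤ C'') : Prop where
  tri_a : ∀ n, IsTriangleFunctor (a n)
  tri_b : ∀ n, IsTriangleFunctor (b n)
  tri_p : ∀ n, IsTriangleFunctor (p n)
  tri_q : ∀ n, IsTriangleFunctor (q n)
  left : ∀ n : ℤ, IsLeftRecollement (p n) (a n) (b n) (q n)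
  right : ∀ n : ℤ, IsLeftRecollement (q n) (b (n + 1)) (a n) (p (n + 1))

/-- The recollement `(i^*, i_*, i^!, j_!, j^*, j_*)` sits in an unbounded ladder, namely as
the `0`-th recollement `(j_{-1}, i_0, j_1, i_{-1}, j_0, i_1)` of the ladder. -/
def SitsInUnboundedLadder (iStar : C ⥤ C') (iPush : C' ⥤ C) (iShriek : C ⥤ C')
    (jShriek : C'' ⥤ C) (jStar : C ⥤ C'') (jPush : C'' ⥤ C) : Prop :=
  ∃ (a : ℤ → C' ⥤ C) (b : ℤ → C'' ⥤ C) (p : ℤ → C ⥤ C') (q : ℤ → C ⥤ C''),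
    IsUnboundedLadder a b p q ∧
    p 0 = iStar ∧ a 0 = iPush ∧ p 1 = iShriek ∧
    b 0 = jShriek ∧ q 0 = jStar ∧ b 1 = jPush

end TriangulatedPreliminaries
universe u₀ v₀

/-- An object `X` of a (preadditive) category is compact if `Hom(X, -)` commutes with
all (small) coproducts, i.e. the additive corepresentable functor `Hom(X, -)` preserves
coproducts. -/
def IsCompactObj {D : Type u₀} [Category.{v₀} D] [Preadditive D] (X : D) : Prop :=
  ∀ α : Type v₀, PreservesColimitsOfShape (Discrete α)
    (preadditiveCoyoneda.obj (Opposite.op X))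
/-- `K^b(proj R)` inside `D(Mod R)`: the subcategory of compact objects of the unbounded
derived category. -/
def KbProjSet (R : Type) [Ring R] [HasDerivedCategory.{1} (ModuleCat.{0} R)] :
    Set (DerivedCategory (ModuleCat.{0} R)) :=
  { X | IsCompactObj X }

/-- `D^b(mod R)` inside `D(Mod R)`: complexes with bounded homology, all of whose homology
modules are finitely generated. -/
noncomputable def DbModSet (R : Type) [Ring R] [HasDerivedCategory.{1} (ModuleCat.{0} R)] :
    Set (DerivedCategory (ModuleCat.{0} R)) :=
  { X | (∃ N : ℕ, ∀ i : ℤ, (N : ℤ) < |i| →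
      IsZero ((DerivedCategory.homologyFunctor (ModuleCat.{0} R) i).obj X)) ∧
    ∀ i : ℤ, Module.Finite R ((DerivedCategory.homologyFunctor (ModuleCat.{0} R) i).obj X) }

/-- `D^-(Mod R)` inside `D(Mod R)`: complexes with homology vanishing in all sufficiently
large (cohomological) degrees. -/
noncomputable def DMinusSet (R : Type) [Ring R] [HasDerivedCategory.{1} (ModuleCat.{0} R)] :
    Set (DerivedCategory (ModuleCat.{0} R)) :=
  { X | ∃ N : ℤ, ∀ i : ℤ, N < i →
      IsZero ((DerivedCategory.homologyFunctor (ModuleCat.{0} R) i).obj X) }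

/-- `D^b(Mod R)` inside `D(Mod R)`: complexes with bounded homology. -/
noncomputable def DbSet (R : Type) [Ring R] [HasDerivedCategory.{1} (ModuleCat.{0} R)] :
    Set (DerivedCategory (ModuleCat.{0} R)) :=
  { X | ∃ N : ℕ, ∀ i : ℤ, (N : ℤ) < |i| →
      IsZero ((DerivedCategory.homologyFunctor (ModuleCat.{0} R) i).obj X) }

/-- A functor between unbounded derived categories of module categories restricts to
`K^b(proj)`, `D^b(mod)`, `D^-(Mod)` and `D^b(Mod)`. -/
noncomputable def RestrictsToAllFour {R S : Type} [Ring R] [Ring S]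
    [HasDerivedCategory.{1} (ModuleCat.{0} R)] [HasDerivedCategory.{1} (ModuleCat.{0} S)]
    (F : DerivedCategory (ModuleCat.{0} R) ⥤ DerivedCategory (ModuleCat.{0} S)) : Prop :=
  Set.MapsTo F.obj (KbProjSet R) (KbProjSet S) ∧
  Set.MapsTo F.obj (DbModSet R) (DbModSet S) ∧
  Set.MapsTo F.obj (DMinusSet R) (DMinusSet S) ∧
  Set.MapsTo F.obj (DbSet R) (DbSet S)

section
open CategoryTheory CategoryTheory.Limits CategoryTheory.Pretriangulated

section Coprod
universe w v u
variable {D : Type u} [Category.{v} D] [Preadditive D]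

/-- Unbundled coproducts in a preadditive category. -/
structure IsCoprod {α : Type w} (Y : α → D) (Z : D) (i : ∀ a, Y a ⟶ Z) : Prop where
  ex : ∀ (W : D) (f : ∀ a, Y a ⟶ W), ∃ g : Z ⟶ W, ∀ a, i a ≫ g = f a
  uniq : ∀ (W : D) (g : Z ⟶ W), (∀ a, i a ≫ g = 0) → g = 0

namespace IsCoprod
variable {α : Type w} {Y : α → D} {Z : D} {i : ∀ a, Y a ⟶ Z}

lemma hom_ext (h : IsCoprod Y Z i) {W : D} {f g : Z ⟶ W} (hfg : ∀ a, i a ≫ f = i a ≫ g) :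
    f = g := by
  rw [← sub_eq_zero]
  apply h.uniq
  intro a
  rw [Preadditive.comp_sub, hfg, sub_self]

lemma of_isColimit {c : Cofan Y} (hc : IsColimit c) : IsCoprod Y c.pt c.inj where
  ex W f := ⟨Cofan.IsColimit.desc hc f, fun a => Cofan.IsColimit.fac hc f a⟩
  uniq W g hg := Cofan.IsColimit.hom_ext hc _ _ (fun a => by simp [hg a])

lemma isColimit (h : IsCoprod Y Z i) : Nonempty (IsColimit (Cofan.mk Z i)) := by
  choose d hd using fun (t : Cofan Y) => h.ex t.pt t.inj
  exact ⟨Cofan.IsColimit.mk _ d (fun t j => hd t j)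
    (fun t m hm => h.hom_ext fun a => (hm a).trans (hd t a).symm)⟩

lemma exists_proj (h : IsCoprod Y Z i) : ∃ p : ∀ a, Z ⟶ Y a,
    (∀ a, i a ≫ p a = 𝟙 _) ∧ ∀ a b, a ≠ b → i a ≫ p b = 0 := by
  classical
  choose p hp using fun b => h.ex (Y b) (fun a => if hab : a = b then eqToHom (by rw [hab]) else 0)
  refine ⟨p, fun a => by simp [hp], fun a b hab => by simp [hp, hab]⟩

/-- The projections. -/
noncomputable def proj (h : IsCoprod Y Z i) (a : α) : Z ⟶ Y a := h.exists_proj.choose a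

@[simp] lemma i_proj (h : IsCoprod Y Z i) (a : α) : i a ≫ h.proj a = 𝟙 _ :=
  h.exists_proj.choose_spec.1 a

lemma i_proj_ne (h : IsCoprod Y Z i) {a b : α} (hab : a ≠ b) : i a ≫ h.proj b = 0 :=
  h.exists_proj.choose_spec.2 a b hab

end IsCoprod

/-- compactness with respect to coproducts indexed by `Type w`. -/
def Cpt (X : D) : Prop :=
  ∀ (α : Type w) (Y : α → D) (Z : D) (i : ∀ a, Y a ⟶ Z), IsCoprod Y Z i → ∀ f : X ⟶ Z,
    ∃ (F : Finset α) (g : ∀ a, X ⟶ Y a), f = ∑ a ∈ F, g a ≫ i a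

lemma IsCoprod.sum_proj {α : Type w} {Y : α → D} {Z : D} {i : ∀ a, Y a ⟶ Z} (h : IsCoprod Y Z i)
    {X : D} (F : Finset α) (g : ∀ a, X ⟶ Y a) (b : α) [Decidable (b ∈ F)] :
    (∑ a ∈ F, g a ≫ i a) ≫ h.proj b = if b ∈ F then g b else 0 := by
  rw [Preadditive.sum_comp]
  split_ifs with hb
  · rw [Finset.sum_eq_single_of_mem b hb]
    · simp
    · intro a _ hab
      rw [Category.assoc, h.i_proj_ne hab, comp_zero]
  · refine Finset.sum_eq_zero fun a ha => ?_
    rw [Category.assoc, h.i_proj_ne, comp_zero]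
    rintro rfl
    exact hb ha

lemma Cpt.exists_finset {X : D} (hX : Cpt.{w} X) {α : Type w} {Y : α → D} {Z : D}
    {i : ∀ a, Y a ⟶ Z} (h : IsCoprod Y Z i) (f : X ⟶ Z) :
    ∃ (F : Finset α), ∀ F', F ⊆ F' → f = ∑ a ∈ F', (f ≫ h.proj a) ≫ i a := by
  classical
  obtain ⟨F, g, hf⟩ := hX α Y Z i h f
  refine ⟨F, fun F' hF => ?_⟩
  conv_rhs => rw [hf]
  simp only [h.sum_proj, ite_comp, zero_comp]
  rw [Finset.sum_ite, Finset.sum_const_zero, add_zero, hf]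
  congr 1
  ext a
  simpa using fun ha => hF ha

lemma Cpt.lower {X : D} (hX : Cpt.{max w v} X) : Cpt.{w} X := by
  intro α Y Z i h f
  have h' : IsCoprod (fun a : ULift.{v} α => Y a.down) Z (fun a => i a.down) :=
    ⟨fun W f => by
      obtain ⟨g, hg⟩ := h.ex W (fun a => f ⟨a⟩)
      exact ⟨g, fun a => hg a.down⟩, fun W g hg => h.uniq W g fun a => hg ⟨a⟩⟩
  obtain ⟨F, g, hf⟩ := hX _ _ _ _ h' f
  refine ⟨F.map ⟨ULift.down, ULift.down_injective⟩, fun a => g ⟨a⟩, ?_⟩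
  rw [hf]
  simp

lemma cpt_of_isCompactObj {X : D} (hX : IsCompactObj X) : Cpt.{v} X := by
  intro α Y Z i h f
  have := hX α
  obtain ⟨hc⟩ := h.isColimit
  have hc' := isColimitOfPreserves (preadditiveCoyoneda.obj (Opposite.op X)) hc
  let S : AddSubgroup (X ⟶ Z) := ⨆ a, (Preadditive.rightComp X (i a)).range
  have hS : S = ⊤ := by
    let q : AddCommGrpCat.of (X ⟶ Z) ⟶ AddCommGrpCat.of ((X ⟶ Z) ⧸ S) :=
      AddCommGrpCat.ofHom (QuotientAddGroup.mk' S)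
    have hq : q = 0 := by
      refine hc'.hom_ext fun ⟨a⟩ => ?_
      ext x
      refine (QuotientAddGroup.eq_zero_iff (N := S) _).2 ?_
      exact (le_iSup (fun a => (Preadditive.rightComp X (i a)).range) a) ⟨x, rfl⟩
    rw [eq_top_iff]
    intro x _
    have := ConcreteCategory.congr_hom hq x
    exact (QuotientAddGroup.eq_zero_iff (N := S) _).1 this
  have hf : f ∈ S := by rw [hS]; trivial
  classical
  induction hf using AddSubgroup.iSup_induction' with
  | hp a x hx =>
    obtain ⟨y, rfl⟩ := hx
    refine ⟨{a}, fun b => if hb : b = a then y ≫ eqToHom (by rw [hb]) else 0, ?_⟩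
    simp [Preadditive.rightComp]
  | h1 => exact ⟨∅, fun _ => 0, by simp⟩
  | hadd x y _ _ hx hy =>
    obtain ⟨F, g, hx⟩ := hx
    obtain ⟨F', g', hy⟩ := hy
    refine ⟨F ∪ F', fun a => (if a ∈ F then g a else 0) + (if a ∈ F' then g' a else 0), ?_⟩
    simp only [Preadditive.add_comp, Finset.sum_add_distrib, ite_comp, zero_comp]
    rw [hx, hy, ← Finset.sum_filter, ← Finset.sum_filter]
    congr 2 <;> · ext; simp; try tauto

lemma isCompactObj_of_cpt {X : D} (hX : Cpt.{v} X) : IsCompactObj X := by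
  intro α
  refine ⟨fun {K} => ⟨fun {c} hc => ?_⟩⟩
  let Y : α → D := fun a => K.obj ⟨a⟩
  have h : IsCoprod Y c.pt (fun a => c.ι.app ⟨a⟩) := by
    refine ⟨fun W f => ⟨hc.desc ⟨W, Discrete.natTrans fun a => f a.as⟩, fun a => ?_⟩,
      fun W g hg => ?_⟩
    · simp
    · refine hc.hom_ext fun ⟨a⟩ => ?_
      simp [hg a]
  have hfin : ∀ f : X ⟶ c.pt, {a | f ≫ h.proj a ≠ 0}.Finite := by
    classical
    intro f
    obtain ⟨F, g, hf⟩ := hX _ _ _ _ h f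
    refine F.finite_toSet.subset fun a ha => ?_
    by_contra hF
    apply ha
    rw [hf, h.sum_proj, if_neg (by simpa using hF)]
  refine ⟨?_⟩
  let G := preadditiveCoyoneda.obj (Opposite.op X)
  let φ : ∀ (s : Cocone (K ⋙ G)) (a : α), (X ⟶ Y a) →+ s.pt := fun s a => (s.ι.app ⟨a⟩).hom
  have hfin' : ∀ (s : Cocone (K ⋙ G)) (f : X ⟶ c.pt),
      (Function.support fun a : α => φ s a (f ≫ h.proj a)).Finite := by
    intro s f
    refine (hfin f).subset fun a ha => ?_
    intro h0
    apply ha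
    show φ s a (f ≫ h.proj a) = 0
    rw [h0]
    exact map_zero _
  exact
  { desc := fun s => AddCommGrpCat.ofHom (AddMonoidHom.mk'
      (fun f : X ⟶ c.pt => ∑ᶠ a : α, φ s a (f ≫ h.proj a)) (by
        intro f g
        rw [← finsum_add_distrib (hfin' s f) (hfin' s g)]
        refine finsum_congr fun a => ?_
        exact (congrArg (φ s a) (Preadditive.add_comp _ _ _ (f : X ⟶ c.pt) g _)).trans
          (map_add _ _ _)))
    fac := by
      rintro s ⟨a⟩
      ext (x : X ⟶ Y a)
      show ∑ᶠ b : α, φ s b ((x ≫ c.ι.app ⟨a⟩) ≫ h.proj b) = φ s a x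
      rw [finsum_eq_single _ a]
      · rw [Category.assoc]
        rw [h.i_proj]
        simp
      · intro b hb
        rw [Category.assoc, h.i_proj_ne hb.symm, comp_zero]
        exact map_zero _
    uniq := by
      intro s m hm
      ext (f : X ⟶ c.pt)
      obtain ⟨F, g, hf⟩ := hX _ _ _ _ h f
      have key : ∀ m' : G.obj c.pt ⟶ s.pt, (∀ j, G.map (c.ι.app j) ≫ m' = s.ι.app j) →
          m'.hom f = ∑ a ∈ F, φ s a (g a) := by
        intro m' hm'
        rw [hf]
        refine (map_sum m'.hom _ _).trans (Finset.sum_congr rfl fun a _ => ?_)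
        exact ConcreteCategory.congr_hom (hm' ⟨a⟩) (g a)
      rw [key m hm]
      refine (key _ ?_).symm
      rintro ⟨a⟩
      ext (x : X ⟶ Y a)
      show ∑ᶠ b : α, φ s b ((x ≫ c.ι.app ⟨a⟩) ≫ h.proj b) = φ s a x
      rw [finsum_eq_single _ a]
      · rw [Category.assoc]
        rw [h.i_proj]
        simp
      · intro b hb
        rw [Category.assoc, h.i_proj_ne hb.symm, comp_zero]
        exact map_zero _ }

end Coprod
end


section
set_option linter.unusedSectionVars false
set_option linter.unusedVariables false
open CategoryTheory CategoryTheory.Limits CategoryTheory.Pretriangulated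

section CoprodAdj
universe w v v' u u'
variable {D : Type u} [Category.{v} D] [Preadditive D]
variable {D' : Type u'} [Category.{v'} D'] [Preadditive D']

lemma IsCoprod.map_leftAdjoint {F : D ⥤ D'} {G : D' ⥤ D} (adj : F ⊣ G) {α : Type w} {Y : α → D}
    {Z : D} {i : ∀ a, Y a ⟶ Z} (h : IsCoprod Y Z i) :
    IsCoprod (fun a => F.obj (Y a)) (F.obj Z) (fun a => F.map (i a)) where
  ex W f := by
    obtain ⟨g, hg⟩ := h.ex (G.obj W) (fun a => adj.homEquiv _ _ (f a))
    refine ⟨(adj.homEquiv _ _).symm g, fun a => ?_⟩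
    rw [← Adjunction.homEquiv_naturality_left_symm, hg]
    simp
  uniq W g hg := by
    apply (adj.homEquiv _ _).injective
    apply h.hom_ext
    intro a
    rw [← Adjunction.homEquiv_naturality_left, ← Adjunction.homEquiv_naturality_left, hg, comp_zero]

lemma Cpt.map_leftAdjoint {F : D ⥤ D'} {G : D' ⥤ D} (adj : F ⊣ G) [F.Additive]
    (hG : ∀ (α : Type w) (Y : α → D') (Z : D') (i : ∀ a, Y a ⟶ Z), IsCoprod Y Z i →
      IsCoprod (fun a => G.obj (Y a)) (G.obj Z) (fun a => G.map (i a))) {X : D}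
    (hX : Cpt.{w} X) : Cpt.{w} (F.obj X) := by
  intro α Y Z i h f
  obtain ⟨s, g, hg⟩ := hX _ _ _ _ (hG _ _ _ _ h) (adj.homEquiv _ _ f)
  refine ⟨s, fun a => (adj.homEquiv _ _).symm (g a), ?_⟩
  apply (adj.homEquiv _ _).injective
  rw [hg]
  apply (adj.homEquiv _ _).symm.injective
  rw [Equiv.symm_apply_apply, Adjunction.homEquiv_counit, F.map_sum, Preadditive.sum_comp]
  refine Finset.sum_congr rfl fun a _ => ?_
  simp [Adjunction.homEquiv_counit]

lemma fin_add {α : Type w} {Y : α → D} {Z : D} {i : ∀ a, Y a ⟶ Z} {X : D} {x y : X ⟶ Z}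
    (hx : ∃ (F : Finset α) (g : ∀ a, X ⟶ Y a), x = ∑ a ∈ F, g a ≫ i a)
    (hy : ∃ (F : Finset α) (g : ∀ a, X ⟶ Y a), y = ∑ a ∈ F, g a ≫ i a) :
    ∃ (F : Finset α) (g : ∀ a, X ⟶ Y a), x + y = ∑ a ∈ F, g a ≫ i a := by
  classical
  obtain ⟨F, g, hx⟩ := hx
  obtain ⟨F', g', hy⟩ := hy
  refine ⟨F ∪ F', fun a => (if a ∈ F then g a else 0) + (if a ∈ F' then g' a else 0), ?_⟩
  simp only [Preadditive.add_comp, Finset.sum_add_distrib, ite_comp, zero_comp]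
  rw [hx, hy, ← Finset.sum_filter, ← Finset.sum_filter]
  congr 2 <;> · ext; simp; try tauto

end CoprodAdj

section Thick
universe w v u
variable {D : Type u} [Category.{v} D] [Preadditive D] [HasZeroObject D] [HasShift D ℤ]
  [∀ n : ℤ, (shiftFunctor D n).Additive] [Pretriangulated D]

section
variable {X Y Z : D} {f : X ⟶ Y} {g : Y ⟶ Z} {h : Z ⟶ X⟦(1 : ℤ)⟧}

lemma tri12 (hT : Triangle.mk f g h ∈ distTriang D) : f ≫ g = 0 := comp_distTriang_mor_zero₁₂ _ hT
lemma tri23 (hT : Triangle.mk f g h ∈ distTriang D) : g ≫ h = 0 := comp_distTriang_mor_zero₂₃ _ hT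
lemma tri31 (hT : Triangle.mk f g h ∈ distTriang D) : h ≫ f⟦(1 : ℤ)⟧' = 0 := comp_distTriang_mor_zero₃₁ _ hT
lemma co2 (hT : Triangle.mk f g h ∈ distTriang D) {P : D}
    (t : P ⟶ Y) (ht : t ≫ g = 0) : ∃ s : P ⟶ X, t = s ≫ f :=
  Triangle.coyoneda_exact₂ _ hT t ht
lemma co3 (hT : Triangle.mk f g h ∈ distTriang D) {P : D}
    (t : P ⟶ Z) (ht : t ≫ h = 0) : ∃ s : P ⟶ Y, t = s ≫ g :=
  Triangle.coyoneda_exact₃ _ hT t ht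
lemma co1 (hT : Triangle.mk f g h ∈ distTriang D) {P : D}
    (t : P ⟶ X⟦(1 : ℤ)⟧) (ht : t ≫ f⟦(1 : ℤ)⟧' = 0) : ∃ s : P ⟶ Z, t = s ≫ h :=
  Triangle.coyoneda_exact₁ _ hT t ht
lemma yo2 (hT : Triangle.mk f g h ∈ distTriang D) {P : D}
    (t : Y ⟶ P) (ht : f ≫ t = 0) : ∃ s : Z ⟶ P, t = g ≫ s :=
  Triangle.yoneda_exact₂ _ hT t ht
lemma yo3 (hT : Triangle.mk f g h ∈ distTriang D) {P : D}
    (t : Z ⟶ P) (ht : g ≫ t = 0) : ∃ s : X⟦(1 : ℤ)⟧ ⟶ P, t = h ≫ s :=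
  Triangle.yoneda_exact₃ _ hT t ht
end

/-- The thick subcategory generated by an object. -/
abbrev thick (T : D) : ObjectProperty D := (ObjectProperty.singleton T).triangEnvelope

lemma thick_self (T : D) : thick T T := ObjectProperty.le_triangEnvelope _ _ (by simp)

/-- Closure conditions. -/
structure IsThick (Q : D → Prop) : Prop where
  ret : ∀ X Y, Retract X Y → Q Y → Q X
  shift : ∀ X (n : ℤ), Q X → Q (X⟦n⟧)
  ext : ∀ T ∈ distTriang D, Q T.obj₁ → Q T.obj₃ → Q T.obj₂

lemma IsThick.iso {Q : D → Prop} (h : IsThick Q) {X Y : D} (e : X ≅ Y) (hX : Q X) : Q Y :=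
  h.ret _ _ (Retract.ofIso e.symm) hX

open ZeroObject in
lemma IsThick.zero {Q : D → Prop} (h : IsThick Q) {X : D} (hX : Q X) : Q (0 : D) :=
  h.ret _ _ ⟨0, 0, by simp⟩ hX

lemma IsThick.unshift {Q : D → Prop} (h : IsThick Q) {X : D} (n : ℤ) (hX : Q (X⟦n⟧)) : Q X :=
  h.iso ((shiftEquiv D n).unitIso.app X).symm (h.shift _ (-n) hX)

lemma IsThick.ext₁ {Q : D → Prop} (h : IsThick Q) (T) (hT : T ∈ distTriang D) (h2 : Q T.obj₂)
    (h3 : Q T.obj₃) : Q T.obj₁ :=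
  h.ext _ (inv_rot_of_distTriang _ hT) (h.shift _ _ h3) h2

lemma IsThick.ext₃ {Q : D → Prop} (h : IsThick Q) (T) (hT : T ∈ distTriang D) (h2 : Q T.obj₁)
    (h3 : Q T.obj₂) : Q T.obj₃ :=
  h.ext _ (rot_of_distTriang _ hT) h3 (h.shift _ _ h2)

lemma thick_induction {Q : D → Prop} (h : IsThick Q) {T : D} (hT : Q T) {X : D}
    (hX : thick T X) : Q X := by
  let Q' : ObjectProperty D := Q
  have h1 : Q'.IsStableUnderRetracts := ⟨fun {X Y} r hY => h.ret X Y r hY⟩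
  have h2 : Q'.IsStableUnderShift ℤ := ⟨fun n => ⟨fun X hX => h.shift X n hX⟩⟩
  have h3 : Q'.IsTriangulatedClosed₂ := .mk' fun T hT => h.ext T hT
  have h4 : Q'.ContainsZero := ⟨⟨_, isZero_zero D, h.zero hT⟩⟩
  have h5 : Q'.IsTriangulated := { }
  refine (ObjectProperty.triangEnvelope_le_iff _ (Q := Q')).2 ?_ _ hX
  intro Y hY
  simp only [ObjectProperty.singleton_iff] at hY
  subst hY
  exact hT

lemma isThick_thick [IsTriangulated D] (T : D) : IsThick (thick T) where
  ret X Y r h := ObjectProperty.IsStableUnderRetracts.of_retract r h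
  shift X n h := (thick T).le_shift n _ h
  ext T hT h1 h3 := ObjectProperty.ext_of_isTriangulatedClosed₂ _ T hT h1 h3

lemma thick_trans [IsTriangulated D] {T U X : D} (h1 : thick T U) (h2 : thick U X) : thick T X :=
  thick_induction (isThick_thick T) h1 h2

lemma IsCoprod.shift {α : Type w} {Y : α → D} {Z : D} {i : ∀ a, Y a ⟶ Z} (h : IsCoprod Y Z i)
    (n : ℤ) : IsCoprod (fun a => (Y a)⟦n⟧) (Z⟦n⟧) (fun a => (i a)⟦n⟧') :=
  h.map_leftAdjoint (shiftEquiv D n).toAdjunction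

lemma isThick_cpt : IsThick (Cpt.{w} (D := D)) where
  ret X Y r h := by
    intro α W Z i hi f
    obtain ⟨F, g, hg⟩ := h _ _ _ _ hi (r.r ≫ f)
    refine ⟨F, fun a => r.i ≫ g a, ?_⟩
    have : f = r.i ≫ r.r ≫ f := by simp
    rw [this, hg, Preadditive.comp_sum]
    simp
  shift X n h := by
    have : (shiftEquiv D n).functor.Additive := inferInstanceAs (shiftFunctor D n).Additive
    exact Cpt.map_leftAdjoint (shiftEquiv D n).toAdjunction (fun α Y Z i hi => hi.shift (-n)) h
  ext T hT h1 h3 := by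
    intro α W Z i hi f
    obtain ⟨F, hF⟩ := h1.exists_finset hi (T.mor₁ ≫ f)
    have hF := hF F subset_rfl
    have h0 : T.mor₁ ≫ (f - ∑ a ∈ F, (f ≫ hi.proj a) ≫ i a) = 0 := by
      rw [Preadditive.comp_sub, Preadditive.comp_sum, sub_eq_zero]
      conv_lhs => rw [hF]
      simp
    obtain ⟨g, hg⟩ := T.yoneda_exact₂ hT _ h0
    have h2 : f = ∑ a ∈ F, (f ≫ hi.proj a) ≫ i a + T.mor₂ ≫ g := by rw [← hg]; abel
    rw [h2]
    refine fin_add ⟨F, _, rfl⟩ ?_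
    obtain ⟨F', g', hg'⟩ := h3 _ _ _ _ hi g
    exact ⟨F', fun a => T.mor₂ ≫ g' a, by rw [hg', Preadditive.comp_sum]; simp⟩

end Thick
end


section
set_option linter.unusedSectionVars false
set_option linter.unusedVariables false
open CategoryTheory CategoryTheory.Limits CategoryTheory.Pretriangulated

section Neeman
universe v u
variable {D : Type u} [Category.{v} D] [Preadditive D] [HasZeroObject D] [HasShift D ℤ]
  [∀ n : ℤ, (shiftFunctor D n).Additive] [Pretriangulated D] [IsTriangulated D]

lemma neeman_step (hcop : ∀ (α : Type) (Y : α → D), ∃ (Z : D) (i : ∀ a, Y a ⟶ Z), IsCoprod Y Z i)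
    (T : D) (hsmall : ∀ (n : ℤ) (X : D), Small.{0} (T⟦n⟧ ⟶ X)) (Z : D) :
    ∃ (Z' : D) (z : Z ⟶ Z'), (∀ (n : ℤ) (f : T⟦n⟧ ⟶ Z), f ≫ z = 0) ∧
      ∃ (α : Type) (ν : α → ℤ) (U : D) (i : ∀ a, T⟦ν a⟧ ⟶ U), IsCoprod _ U i ∧
      ∀ (P : D) (f : P ⟶ Z), f ≫ z = 0 → ∃ (t : P ⟶ U) (u : U ⟶ Z), f = t ≫ u := by
  have := hsmall
  obtain ⟨U, i, hi⟩ := hcop (Σ n : ℤ, Shrink.{0} (T⟦n⟧ ⟶ Z)) (fun a => T⟦a.1⟧)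
  obtain ⟨u, hu⟩ := hi.ex Z (fun a => (equivShrink _).symm a.2)
  obtain ⟨Z', z, w, hT⟩ := distinguished_cocone_triangle u
  refine ⟨Z', z, ?_, _, _, U, i, hi, ?_⟩
  · intro n f
    have h1 := hu ⟨n, equivShrink _ f⟩
    have h2 : u ≫ z = 0 := comp_distTriang_mor_zero₁₂ _ hT
    simp only [Equiv.symm_apply_apply] at h1
    rw [← h1, Category.assoc, h2, comp_zero]
  · intro P f hf
    obtain ⟨t, ht⟩ := co2 hT f hf
    exact ⟨t, u, ht⟩

lemma kill_finite (T : D) {α : Type} (ν : α → ℤ) (F : Finset α) (P : D) (g : ∀ a, P ⟶ T⟦ν a⟧) :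
    ∃ (P' : D) (p : P' ⟶ P), (thick T).trW p ∧ ∀ a ∈ F, p ≫ g a = 0 := by
  classical
  induction F using Finset.induction_on with
  | empty => exact ⟨P, 𝟙 P, MorphismProperty.id_mem _ _, by simp⟩
  | insert a F ha ih =>
    obtain ⟨P', p, hp, hF⟩ := ih
    obtain ⟨P'', p', w, hT⟩ := distinguished_cocone_triangle₁ (p ≫ g a)
    refine ⟨P'', p' ≫ p, MorphismProperty.comp_mem _ _ _ ?_ hp, ?_⟩
    · exact ObjectProperty.trW.mk _ hT ((isThick_thick T).shift _ _ (thick_self T))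
    · intro b hb
      rw [Finset.mem_insert] at hb
      rcases hb with rfl | hb
      · rw [Category.assoc]
        exact comp_distTriang_mor_zero₁₂ _ hT
      · rw [Category.assoc, hF b hb, comp_zero]

lemma neeman_tower
    (hcop : ∀ (α : Type) (Y : α → D), ∃ (Z : D) (i : ∀ a, Y a ⟶ Z), IsCoprod Y Z i)
    (T : D) (hT : Cpt.{0} T) 
    (hgen : ∀ X : D, (∀ (n : ℤ) (f : T⟦n⟧ ⟶ X), f = 0) → IsZero X) (P : D) (hP : Cpt.{0} P)
    (Zt : ℕ → D) (zt : ∀ n, Zt n ⟶ Zt (n + 1))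
    (hz : ∀ (m : ℕ) (n : ℤ) (f : T⟦n⟧ ⟶ Zt m), f ≫ zt m = 0) (f : P ⟶ Zt 0) :
    ∃ c : ∀ n, P ⟶ Zt n, c 0 = f ∧ (∀ n, c (n + 1) = c n ≫ zt n) ∧ ∃ N, c N = 0 := by
  obtain ⟨S, ι, hS⟩ := hcop ℕ Zt
  obtain ⟨s, hs⟩ := hS.ex S (fun n => zt n ≫ ι (n + 1))
  have hTs : ∀ (n : ℤ) (f : T⟦n⟧ ⟶ S), f ≫ s = 0 := by
    intro n f
    obtain ⟨F, g, hf⟩ := isThick_cpt.shift T n hT _ _ _ _ hS f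
    rw [hf, Preadditive.sum_comp]
    refine Finset.sum_eq_zero fun a _ => ?_
    rw [Category.assoc, hs, ← Category.assoc, hz, zero_comp]
  have hTs' : ∀ (n : ℤ) (f : T⟦n⟧ ⟶ S⟦(1 : ℤ)⟧), f ≫ s⟦(1 : ℤ)⟧' = 0 := by
    intro n f
    let e : T⟦n⟧ ≅ (T⟦n - 1⟧)⟦(1 : ℤ)⟧ := (shiftFunctorAdd' D (n - 1) 1 n (by lia)).app T
    obtain ⟨f', hf'⟩ := (shiftFunctor D (1 : ℤ)).map_surjective (e.inv ≫ f)
    have : f = e.hom ≫ f'⟦(1 : ℤ)⟧' := by rw [hf']; simp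
    rw [this, Category.assoc, ← Functor.map_comp, hTs, Functor.map_zero, comp_zero]
  obtain ⟨W, v, d, hW⟩ := distinguished_cocone_triangle (𝟙 S - s)
  have hW0 : IsZero W := by
    refine hgen W fun n f => ?_
    have h1 : f ≫ d = 0 := by
      have h2 : d ≫ (𝟙 S - s)⟦(1 : ℤ)⟧' = 0 := comp_distTriang_mor_zero₃₁ _ hW
      have h3 : (f ≫ d) ≫ (𝟙 S - s)⟦(1 : ℤ)⟧' = 0 := by rw [Category.assoc, h2, comp_zero]
      rw [Functor.map_sub, Preadditive.comp_sub, hTs', sub_zero] at h3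
      simpa using h3
    obtain ⟨h, hh⟩ := co3 hW f h1
    have h2 : h ≫ (𝟙 S - s) = h := by rw [Preadditive.comp_sub, hTs]; simp
    have h4 : (𝟙 S - s) ≫ v = 0 := comp_distTriang_mor_zero₁₂ _ hW
    rw [hh, ← h2, Category.assoc, h4, comp_zero]
  have hiso : IsIso (𝟙 S - s) := (Triangle.isZero₃_iff_isIso₁ _ hW).1 hW0
  obtain ⟨h, hh⟩ : ∃ h : P ⟶ S, h ≫ (𝟙 S - s) = f ≫ ι 0 :=
    ⟨(f ≫ ι 0) ≫ inv (𝟙 S - s), by rw [Category.assoc, IsIso.inv_hom_id, Category.comp_id]⟩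
  have hs0 : s ≫ hS.proj 0 = 0 := hS.uniq _ _ fun a => by
    rw [← Category.assoc, hs, Category.assoc, hS.i_proj_ne (by simp), comp_zero]
  have hs1 : ∀ n, s ≫ hS.proj (n + 1) = hS.proj n ≫ zt n := fun n => hS.hom_ext fun a => by
    rw [← Category.assoc, hs, Category.assoc]
    by_cases han : a = n
    · subst han
      rw [hS.i_proj, ← Category.assoc, hS.i_proj]
      simp
    · rw [hS.i_proj_ne (by simpa using han), ← Category.assoc, hS.i_proj_ne han]
      simp
  have hc0 : h ≫ hS.proj 0 = f := by
    have := congrArg (· ≫ hS.proj 0) hh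
    simp only [Category.assoc, Preadditive.sub_comp, hs0, sub_zero, Category.id_comp,
      hS.i_proj, Category.comp_id] at this
    exact this
  have hc1 : ∀ n, h ≫ hS.proj (n + 1) = (h ≫ hS.proj n) ≫ zt n := by
    intro n
    have := congrArg (· ≫ hS.proj (n + 1)) hh
    simp only [Category.assoc, Preadditive.sub_comp, Category.id_comp, hs1,
      Preadditive.comp_sub] at this
    rw [hS.i_proj_ne (by simp), comp_zero, sub_eq_zero] at this
    rw [this, Category.assoc]
  obtain ⟨N, hN⟩ : ∃ N, h ≫ hS.proj N = 0 := by
    classical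
    obtain ⟨F, g, hf⟩ := hP _ _ _ _ hS h
    obtain ⟨N, hN⟩ := Infinite.exists_notMem_finset F
    exact ⟨N, by rw [hf, hS.sum_proj, if_neg hN]⟩
  exact ⟨fun n => h ≫ hS.proj n, hc0, hc1, N, hN⟩

lemma neeman_back (T : D) (hT : Cpt.{0} T) (P : D) (hP : Cpt.{0} P)
    (Zt : ℕ → D) (zt : ∀ n, Zt n ⟶ Zt (n + 1))
    (hfac : ∀ n, ∃ (α : Type) (ν : α → ℤ) (U : D) (i : ∀ a, T⟦ν a⟧ ⟶ U), IsCoprod _ U i ∧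
      ∀ (P : D) (f : P ⟶ Zt n), f ≫ zt n = 0 → ∃ (t : P ⟶ U) (u : U ⟶ Zt n), f = t ≫ u)
    (c : ∀ n, P ⟶ Zt n) (hc1 : ∀ n, c (n + 1) = c n ≫ zt n) (N : ℕ) (hN : c N = 0) :
    ∃ (P' : D) (p : P' ⟶ P), (thick T).trW p ∧ p ≫ c 0 = 0 := by
  have claim : ∀ m n, m + n = N → ∃ (P' : D) (p : P' ⟶ P), Cpt.{0} P' ∧ (thick T).trW p ∧
      p ≫ c n = 0 := by
    intro m
    induction m with
    | zero =>
      intro n hn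
      obtain rfl : n = N := by lia
      exact ⟨P, 𝟙 P, hP, MorphismProperty.id_mem _ _, by rw [hN]; simp⟩
    | succ m ih =>
      intro n hn
      obtain ⟨P', p, hP', hp, hpn⟩ := ih (n + 1) (by lia)
      have hpn : (p ≫ c n) ≫ zt n = 0 := by
        rw [Category.assoc, ← hc1]; exact hpn
      obtain ⟨α, ν, U, i, hi, hfac⟩ := hfac n
      obtain ⟨t, u, htu⟩ := hfac P' (p ≫ c n) hpn
      obtain ⟨F, g, hg⟩ := hP' _ _ _ _ hi t
      obtain ⟨P'', p', hp', hF⟩ := kill_finite T _ F P' g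
      refine ⟨P'', p' ≫ p, ?_, MorphismProperty.comp_mem _ _ _ hp' hp, ?_⟩
      · obtain ⟨Q, a, b, hab, hQ⟩ := (ObjectProperty.trW_iff _ _).1 hp'
        exact isThick_cpt.ext₁ _ hab hP' (thick_induction isThick_cpt hT hQ)
      · rw [Category.assoc, htu, hg, Preadditive.sum_comp, Preadditive.comp_sum]
        refine Finset.sum_eq_zero fun a ha => ?_
        rw [← Category.assoc, ← Category.assoc, hF a ha, zero_comp, zero_comp]
  obtain ⟨P', p, -, hp, hp0⟩ := claim N 0 (by simp)
  exact ⟨P', p, hp, hp0⟩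

lemma neeman (hcop : ∀ (α : Type) (Y : α → D), ∃ (Z : D) (i : ∀ a, Y a ⟶ Z), IsCoprod Y Z i)
    (T : D) (hT : Cpt.{0} T) (hsmall : ∀ (n : ℤ) (X : D), Small.{0} (T⟦n⟧ ⟶ X))
    (hgen : ∀ X : D, (∀ (n : ℤ) (f : T⟦n⟧ ⟶ X), f = 0) → IsZero X) (P : D) (hP : Cpt.{0} P) :
    thick T P := by
  choose nx z hz hfac using neeman_step hcop T hsmall
  let Zt : ℕ → D := fun n => Nat.rec P (fun _ Z => nx Z) n
  let zt : ∀ n, Zt n ⟶ Zt (n + 1) := fun n => z (Zt n)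
  obtain ⟨c, hc0, hc1, N, hN⟩ := neeman_tower hcop T hT hgen P hP Zt zt (fun m => hz (Zt m)) (𝟙 P)
  obtain ⟨P', p, hp, hp0⟩ := neeman_back T hT P hP Zt zt (fun n => hfac (Zt n)) c hc1 N hN
  replace hp0 : p ≫ 𝟙 P = 0 := by rw [hc0] at hp0; exact hp0
  obtain ⟨Q, a, b, hab, hQ⟩ := (ObjectProperty.trW_iff _ _).1 hp
  obtain ⟨r, hr⟩ := yo2 hab (𝟙 P) hp0
  exact (isThick_thick T).ret _ _ ⟨a, r, hr.symm⟩ hQ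

end Neeman
end


section
open CategoryTheory CategoryTheory.Limits CategoryTheory.Pretriangulated

section Elem
variable {R : Type} [Ring R]

lemma mcx_surj (K : CochainComplex (ModuleCat.{0} R) ℤ) (n : ℤ) (h : K.homology n) :
    ∃ z : K.cycles n, K.homologyπ n z = h :=
  (ModuleCat.epi_iff_surjective (K.homologyπ n)).1 inferInstance h

lemma mcx_zero (K : CochainComplex (ModuleCat.{0} R) ℤ) (m n : ℤ) (hmn : m + 1 = n)
    (z : K.cycles n) :
    K.homologyπ n z = 0 ↔ ∃ y : K.X m, K.d m n y = K.iCycles n z := by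
  have hex := (ShortComplex.exact_of_g_is_cokernel (ShortComplex.mk _ _ (K.toCycles_comp_homologyπ m n))
    (K.homologyIsCokernel m n (by simp [← hmn])))
  rw [ShortComplex.moduleCat_exact_iff] at hex
  constructor
  · intro h
    obtain ⟨y, hy⟩ := hex z h
    refine ⟨y, ?_⟩
    rw [← K.toCycles_i m n, ← hy]; rfl
  · rintro ⟨y, hy⟩
    have : K.toCycles m n y = z := by
      apply (ModuleCat.mono_iff_injective (K.iCycles n)).1 inferInstance
      rw [← hy, ← K.toCycles_i m n]; rfl
    rw [← this]
    exact ConcreteCategory.congr_hom (K.toCycles_comp_homologyπ m n) y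

lemma mcx_d (K : CochainComplex (ModuleCat.{0} R) ℤ) (n p : ℤ) (z : K.cycles n) :
    K.d n p (K.iCycles n z) = 0 :=
  ConcreteCategory.congr_hom (K.iCycles_d n p) z

lemma mcx_mk (K : CochainComplex (ModuleCat.{0} R) ℤ) (n p : ℤ) (hnp : n + 1 = p) (x : K.X n)
    (hx : K.d n p x = 0) : ∃ z : K.cycles n, K.iCycles n z = x := by
  have hex := (ShortComplex.exact_of_f_is_kernel (ShortComplex.mk _ _ (K.iCycles_d n p))
    (K.cyclesIsKernel n p (by simp [← hnp])))
  rw [ShortComplex.moduleCat_exact_iff] at hex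
  exact hex x hx

lemma mcx_iCycles_inj (K : CochainComplex (ModuleCat.{0} R) ℤ) (n : ℤ) :
    Function.Injective (K.iCycles n) :=
  (ModuleCat.mono_iff_injective (K.iCycles n)).1 inferInstance

lemma mcx_quasiIso {K L : CochainComplex (ModuleCat.{0} R) ℤ} (φ : K ⟶ L) :
    QuasiIso φ ↔ (∀ (m n p : ℤ), m + 1 = n → n + 1 = p →
      (∀ (x : K.X n) (y : L.X m), K.d n p x = 0 → L.d m n y = φ.f n x → ∃ w : K.X m, K.d m n w = x) ∧
      (∀ y : L.X n, L.d n p y = 0 → ∃ (x : K.X n) (w : L.X m), K.d n p x = 0 ∧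
        φ.f n x = y + L.d m n w)) := by
  have nat1 : ∀ n (z : K.cycles n), HomologicalComplex.homologyMap φ n (K.homologyπ n z) =
      L.homologyπ n (HomologicalComplex.cyclesMap φ n z) := fun n z =>
    ConcreteCategory.congr_hom (HomologicalComplex.homologyπ_naturality φ n) z
  have nat2 : ∀ n (z : K.cycles n), L.iCycles n (HomologicalComplex.cyclesMap φ n z) =
      φ.f n (K.iCycles n z) := fun n z =>
    ConcreteCategory.congr_hom (HomologicalComplex.cyclesMap_i φ n) z
  rw [quasiIso_iff]
  simp only [quasiIsoAt_iff_isIso_homologyMap, ConcreteCategory.isIso_iff_bijective]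
  constructor
  · intro h m n p hmn hnp
    refine ⟨fun x y hx hy => ?_, fun y hy => ?_⟩
    · obtain ⟨z, rfl⟩ := mcx_mk K n p hnp x hx
      have h0 : K.homologyπ n z = 0 := by
        apply (h n).1
        rw [nat1, map_zero, mcx_zero L m n hmn]
        exact ⟨y, by rw [hy, nat2]⟩
      exact (mcx_zero K m n hmn z).1 h0
    · obtain ⟨z, rfl⟩ := mcx_mk L n p hnp y hy
      obtain ⟨u, hu⟩ := (h n).2 (L.homologyπ n z)
      obtain ⟨t, rfl⟩ := mcx_surj K n u
      have h0 : L.homologyπ n (HomologicalComplex.cyclesMap φ n t - z) = 0 := by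
        rw [map_sub, ← hu, nat1, sub_self]
      obtain ⟨w, hw⟩ := (mcx_zero L m n hmn _).1 h0
      refine ⟨K.iCycles n t, w, mcx_d K n p t, ?_⟩
      rw [hw, map_sub, nat2]
      abel
  · intro h n
    obtain ⟨h1, h2⟩ := h (n - 1) n (n + 1) (by ring) rfl
    constructor
    · change Function.Injective (HomologicalComplex.homologyMap φ n).hom
      rw [injective_iff_map_eq_zero]
      intro u hu
      obtain ⟨t, rfl⟩ := mcx_surj K n u
      have hu' : HomologicalComplex.homologyMap φ n (K.homologyπ n t) = 0 := hu
      rw [nat1, mcx_zero L (n - 1) n (by ring)] at hu'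
      obtain ⟨y, hy⟩ := hu'
      exact (mcx_zero K (n - 1) n (by ring) t).2 (h1 _ y (mcx_d K n _ t) (by rw [hy, nat2]))
    · intro u
      obtain ⟨t, rfl⟩ := mcx_surj L n u
      obtain ⟨x, w, hx, hw⟩ := h2 (L.iCycles n t) (mcx_d L n _ t)
      obtain ⟨z, rfl⟩ := mcx_mk K n _ rfl x hx
      refine ⟨K.homologyπ n z, ?_⟩
      have h0 : L.homologyπ n (HomologicalComplex.cyclesMap φ n z - t) = 0 := by
        rw [mcx_zero L (n - 1) n (by ring)]
        exact ⟨w, by rw [map_sub, nat2, hw]; abel⟩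
      rw [map_sub, sub_eq_zero, ← nat1] at h0
      exact h0
end Elem
end


section
open CategoryTheory CategoryTheory.Limits CategoryTheory.Pretriangulated

section DSum
variable {R : Type} [Ring R] {α : Type}

/-- Direct sum of complexes. -/
noncomputable def dsum (K : α → CochainComplex (ModuleCat.{0} R) ℤ) :
    CochainComplex (ModuleCat.{0} R) ℤ where
  X n := ModuleCat.of R (Π₀ a, (K a).X n)
  d m n := ModuleCat.ofHom (DFinsupp.mapRange.linearMap fun a => ((K a).d m n).hom)
  shape m n h := by
    ext x a
    simp [(K a).shape m n h]
  d_comp_d' m n p _ _ := by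
    ext x a
    exact ConcreteCategory.congr_hom ((K a).d_comp_d m n p) (x a)

@[simp] lemma dsum_d_apply (K : α → CochainComplex (ModuleCat.{0} R) ℤ) (m n : ℤ)
    (x : Π₀ a, (K a).X m) (a : α) :
    DFunLike.coe (F := Π₀ a, (K a).X n) ((dsum K).d m n x) a = (K a).d m n (x a) := rfl

variable {K K' : α → CochainComplex (ModuleCat.{0} R) ℤ} {L : CochainComplex (ModuleCat.{0} R) ℤ}

open Classical in
/-- inclusion -/
noncomputable def dsumι (K : α → CochainComplex (ModuleCat.{0} R) ℤ) (a : α) : K a ⟶ dsum K where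
  f n := ModuleCat.ofHom (DFinsupp.lsingle (M := fun a => (K a).X n) a)
  comm' m n _ := by
    ext x
    exact (DFinsupp.mapRange_single (f := fun a => ((K a).d m n).hom) (hf := fun a => by simp))

open Classical in
lemma dsum_hom_ext_f {n : ℤ} {X : ModuleCat.{0} R} {f g : (dsum K).X n ⟶ X}
    (h : ∀ a, (dsumι K a).f n ≫ f = (dsumι K a).f n ≫ g) : f = g := by
  apply ModuleCat.hom_ext
  refine DFinsupp.lhom_ext fun a x => ?_
  exact ConcreteCategory.congr_hom (h a) x

open Classical in
/-- descent in one degree -/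
noncomputable def dsumDescF {n : ℤ} {X : ModuleCat.{0} R} (f : ∀ a, (K a).X n ⟶ X) :
    (dsum K).X n ⟶ X :=
  ModuleCat.ofHom (DFinsupp.lsum ℤ fun a => (f a).hom)

open Classical in
lemma dsumι_descF {n : ℤ} {X : ModuleCat.{0} R} (f : ∀ a, (K a).X n ⟶ X) (a : α) :
    (dsumι K a).f n ≫ dsumDescF f = f a := by
  ext x
  exact DFinsupp.lsum_single ℤ (fun a => (f a).hom) a x

lemma dsumι_descF_assoc {n : ℤ} {X X' : ModuleCat.{0} R} (f : ∀ a, (K a).X n ⟶ X) (a : α)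
    (g : X ⟶ X') : (dsumι K a).f n ≫ dsumDescF f ≫ g = f a ≫ g := by
  rw [← Category.assoc, dsumι_descF]

/-- descent -/
noncomputable def dsumDesc (f : ∀ a, K a ⟶ L) : dsum K ⟶ L where
  f n := dsumDescF fun a => (f a).f n
  comm' m n _ := by
    refine dsum_hom_ext_f fun a => ?_
    rw [dsumι_descF_assoc, HomologicalComplex.Hom.comm_assoc, dsumι_descF, (f a).comm]

@[simp]
lemma dsumι_desc (f : ∀ a, K a ⟶ L) (a : α) :
    dsumι K a ≫ dsumDesc f = f a := by
  ext1 n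
  exact dsumι_descF _ _

lemma dsum_hom_ext {f g : dsum K ⟶ L} (h : ∀ a, dsumι K a ≫ f = dsumι K a ≫ g) : f = g := by
  ext1 n
  refine dsum_hom_ext_f fun a => ?_
  exact HomologicalComplex.congr_hom (h a) n

/-- map -/
noncomputable def dsumMap (s : ∀ a, K' a ⟶ K a) : dsum K' ⟶ dsum K :=
  dsumDesc fun a => s a ≫ dsumι K a

lemma dsumι_map (s : ∀ a, K' a ⟶ K a) (a : α) :
    dsumι K' a ≫ dsumMap s = s a ≫ dsumι K a := by simp [dsumMap]

lemma dsumMap_apply (s : ∀ a, K' a ⟶ K a) (n : ℤ) (x : Π₀ a, (K' a).X n) (a : α) :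
    DFunLike.coe (F := Π₀ a, (K a).X n) ((dsumMap s).f n x) a = (s a).f n (x a) := by
  have : (dsumMap s).f n = ModuleCat.ofHom (DFinsupp.mapRange.linearMap fun a => ((s a).f n).hom) := by
    refine dsum_hom_ext_f fun a => ?_
    have := HomologicalComplex.congr_hom (dsumι_map s a) n
    refine this.trans ?_
    classical
    ext x
    refine ((DFinsupp.mapRange_single (f := fun a => ((s a).f n).hom) (hf := fun a => by simp)).trans ?_).symm
    dsimp [dsumι]
    congr!
  rw [this]
  rfl

lemma dfinsupp_choice {P : α → Type} {Q : α → Type} [∀ a, Zero (P a)] [∀ a, Zero (Q a)]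
    (y : Π₀ a, P a) (S : ∀ a, P a → Q a → Prop) (h0 : ∀ a, S a 0 0) (h : ∀ a, ∃ w, S a (y a) w) :
    ∃ w : Π₀ a, Q a, ∀ a, S a (y a) (w a) := by
  classical
  choose w hw using h
  refine ⟨DFinsupp.mk y.support fun a => w a, fun a => ?_⟩
  by_cases ha : a ∈ y.support
  · simpa [DFinsupp.mk_apply, ha] using hw a
  · have : y a = 0 := by simpa using ha
    simp only [DFinsupp.mk_apply, ha, dite_false, this]
    exact h0 a

lemma dsumMap_quasiIso (s : ∀ a, K' a ⟶ K a) (hs : ∀ a, QuasiIso (s a)) : QuasiIso (dsumMap s) := by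
  rw [mcx_quasiIso]
  intro m n p hmn hnp
  have h1 := fun a => ((mcx_quasiIso (s a)).1 (hs a) m n p hmn hnp).1
  have h2 := fun a => ((mcx_quasiIso (s a)).1 (hs a) m n p hmn hnp).2
  constructor
  · intro (x : Π₀ a, (K' a).X n) (y : Π₀ a, (K a).X m) hx hy
    obtain ⟨w, hw⟩ := dfinsupp_choice x (fun a x w => (K' a).d m n w = x) (fun a => by simp)
      (fun a => h1 a (x a) (y a) (by rw [← dsum_d_apply, hx]; rfl)
        (by rw [← dsum_d_apply, hy, dsumMap_apply]))
    exact ⟨w, DFinsupp.ext hw⟩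
  · intro (y : Π₀ a, (K a).X n) hy
    obtain ⟨w, hw⟩ := dfinsupp_choice (Q := fun a => (K' a).X n × (K a).X m) y
      (fun a y w => (K' a).d n p w.1 = 0 ∧ (s a).f n w.1 = y + (K a).d m n w.2)
      (fun a => by simp)
      (fun a => by
        obtain ⟨x, w, hx⟩ := h2 a (y a) (by rw [← dsum_d_apply, hy]; rfl)
        exact ⟨(x, w), hx⟩)
    refine ⟨(w.mapRange (fun a => Prod.fst) (fun _ => rfl) : Π₀ a, (K' a).X n),
      (w.mapRange (fun a => Prod.snd) (fun _ => rfl) : Π₀ a, (K a).X m), ?_, ?_⟩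
    · refine DFinsupp.ext fun a => ?_
      exact (hw a).1
    · refine DFinsupp.ext fun a => ?_
      rw [dsumMap_apply]
      exact (hw a).2

/-- sums of null homotopies -/
noncomputable def dsumHomotopy (g : dsum K ⟶ L) (h : ∀ a, Homotopy (dsumι K a ≫ g) 0) :
    Homotopy g 0 where
  hom i j := dsumDescF fun a => (h a).hom i j
  zero i j hij := by
    refine dsum_hom_ext_f fun a => ?_
    rw [dsumι_descF, (h a).zero i j hij, comp_zero]
  comm i := by
    refine dsum_hom_ext_f fun a => ?_
    have := (h a).comm i
    rw [HomologicalComplex.comp_f] at this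
    rw [this]
    simp only [Preadditive.comp_add]
    congr 1
    congr 1
    · simp only [dNext_eq _ (show (ComplexShape.up ℤ).Rel i (i+1) from rfl)]
      rw [HomologicalComplex.Hom.comm_assoc, dsumι_descF]
    · simp only [prevD_eq _ (show (ComplexShape.up ℤ).Rel (i-1) i by simp)]
      rw [dsumι_descF_assoc]

end DSum
end


section
open CategoryTheory CategoryTheory.Limits CategoryTheory.Pretriangulated

section DR
variable {R : Type} [Ring R] [HasDerivedCategory.{1} (ModuleCat.{0} R)]

variable (R) in
/-- The derived category of `R`-modules. -/
abbrev DMod := DerivedCategory (ModuleCat.{0} R)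

lemma Q_map_eq_zero {K L : CochainComplex (ModuleCat.{0} R) ℤ} {f : K ⟶ L} (h : Homotopy f 0) :
    DerivedCategory.Q.map f = 0 := by
  have : (HomotopyCategory.quotient _ _).map f = 0 := by
    rw [HomotopyCategory.eq_of_homotopy _ _ h, Functor.map_zero]
  have h2 : DerivedCategory.Qh.map ((HomotopyCategory.quotient _ _).map f) = 0 := by
    rw [this, Functor.map_zero]
  have e := (DerivedCategory.quotientCompQhIso (ModuleCat.{0} R)).inv.naturality f
  dsimp at e
  rw [h2, comp_zero] at e
  rw [← cancel_mono ((DerivedCategory.quotientCompQhIso (ModuleCat.{0} R)).inv.app L), e, zero_comp]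

lemma Q_map_zero_iff {K L : CochainComplex (ModuleCat.{0} R) ℤ} {f : K ⟶ L}
    (hf : DerivedCategory.Q.map f = 0) :
    ∃ (K' : CochainComplex (ModuleCat.{0} R) ℤ) (s : K' ⟶ K) (_ : QuasiIso s),
      Nonempty (Homotopy (s ≫ f) 0) := by
  have h2 : DerivedCategory.Qh.map ((HomotopyCategory.quotient _ _).map f) = DerivedCategory.Qh.map 0 := by
    have e := (DerivedCategory.quotientCompQhIso (ModuleCat.{0} R)).hom.naturality f
    dsimp at e
    rw [hf, comp_zero] at e
    rw [← cancel_mono ((DerivedCategory.quotientCompQhIso (ModuleCat.{0} R)).hom.app L), e, 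
      Functor.map_zero, zero_comp]
  rw [MorphismProperty.map_eq_iff_precomp DerivedCategory.Qh
    (HomotopyCategory.quasiIso (ModuleCat.{0} R) (ComplexShape.up ℤ))] at h2
  obtain ⟨Z, s, hs, h⟩ := h2
  obtain ⟨K', rfl⟩ := HomotopyCategory.quotient_obj_surjective Z
  obtain ⟨s, rfl⟩ := (HomotopyCategory.quotient _ _).map_surjective s
  refine ⟨K', s, ?_, ?_⟩
  · exact (HomotopyCategory.quotient_map_mem_quasiIso_iff s).1 hs
  · rw [comp_zero, ← Functor.map_comp, ← (HomotopyCategory.quotient _ _).map_zero] at h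
    exact ⟨HomotopyCategory.homotopyOfEq _ _ h⟩

lemma D_coprod_Q {α : Type} (K : α → CochainComplex (ModuleCat.{0} R) ℤ) :
    IsCoprod (D := DMod R) (fun a => DerivedCategory.Q.obj (K a)) (DerivedCategory.Q.obj (dsum K))
      (fun a => DerivedCategory.Q.map (dsumι K a)) where
  ex W f := by
    obtain ⟨L, ⟨e⟩⟩ : ∃ L, Nonempty (DerivedCategory.Q.obj L ≅ W) :=
      ⟨_, ⟨DerivedCategory.Q.objObjPreimageIso W⟩⟩
    choose K' s hs g hf using fun a => DerivedCategory.right_fac (f a ≫ e.inv)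
    have hs' : IsIso (DerivedCategory.Q.map (dsumMap s)) := by
      rw [DerivedCategory.isIso_Q_map_iff_quasiIso]
      exact dsumMap_quasiIso s fun a => by rw [← DerivedCategory.isIso_Q_map_iff_quasiIso]; exact hs a
    refine ⟨inv (DerivedCategory.Q.map (dsumMap s)) ≫ DerivedCategory.Q.map (dsumDesc g) ≫ e.hom,
      fun a => ?_⟩
    have h1 : DerivedCategory.Q.map (dsumι K a) ≫ inv (DerivedCategory.Q.map (dsumMap s)) =
        inv (DerivedCategory.Q.map (s a)) ≫ DerivedCategory.Q.map (dsumι K' a) := by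
      rw [IsIso.comp_inv_eq, Category.assoc, IsIso.eq_inv_comp, ← Functor.map_comp,
        ← Functor.map_comp, dsumι_map]
    rw [← Category.assoc, h1, Category.assoc, ← Functor.map_comp_assoc, dsumι_desc,
      ← Category.assoc, ← hf, Category.assoc, e.inv_hom_id, Category.comp_id]
  uniq W g hg := by
    obtain ⟨L, ⟨e⟩⟩ : ∃ L, Nonempty (DerivedCategory.Q.obj L ≅ W) :=
      ⟨_, ⟨DerivedCategory.Q.objObjPreimageIso W⟩⟩
    obtain ⟨L', g', s, hs, h⟩ := DerivedCategory.left_fac (g ≫ e.inv)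
    have h0 : DerivedCategory.Q.map g' = 0 := by
      have : ∀ a, DerivedCategory.Q.map (dsumι K a ≫ g') = 0 := by
        intro a
        have : DerivedCategory.Q.map g' = g ≫ e.inv ≫ DerivedCategory.Q.map s := by
          rw [← Category.assoc, h, Category.assoc, IsIso.inv_hom_id, Category.comp_id]
        rw [Functor.map_comp, this, ← Category.assoc, hg, zero_comp]
      choose K' t ht hh using fun a => Q_map_zero_iff (this a)
      have ht' : IsIso (DerivedCategory.Q.map (dsumMap t)) := by
        rw [DerivedCategory.isIso_Q_map_iff_quasiIso]
        exact dsumMap_quasiIso t ht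
      have := Q_map_eq_zero (dsumHomotopy (dsumMap t ≫ g') fun a => by
        rw [← Category.assoc, dsumι_map, Category.assoc]
        exact (hh a).some)
      rw [Functor.map_comp] at this
      rw [← cancel_epi (DerivedCategory.Q.map (dsumMap t)), this, comp_zero]
    rw [← cancel_mono e.inv, h, h0, zero_comp, zero_comp]

lemma IsCoprod.of_iso {D : Type*} [Category D] [Preadditive D] {α : Type*} {Y Y' : α → D} {Z : D}
    {i : ∀ a, Y a ⟶ Z} (h : IsCoprod Y Z i) (e : ∀ a, Y' a ≅ Y a) :
    IsCoprod Y' Z (fun a => (e a).hom ≫ i a) where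
  ex W f := by
    obtain ⟨g, hg⟩ := h.ex W (fun a => (e a).inv ≫ f a)
    exact ⟨g, fun a => by rw [Category.assoc, hg, Iso.hom_inv_id_assoc]⟩
  uniq W g hg := h.uniq W g fun a => by
    rw [← cancel_epi (e a).hom, ← Category.assoc, hg, comp_zero]

lemma D_coprod (α : Type) (Y : α → DMod R) : ∃ (Z : DMod R) (i : ∀ a, Y a ⟶ Z), IsCoprod Y Z i :=
  ⟨_, _, (D_coprod_Q (fun a => DerivedCategory.Q.objPreimage (Y a))).of_iso
    (fun a => (DerivedCategory.Q.objObjPreimageIso (Y a)).symm)⟩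

end DR
end


section
open CategoryTheory CategoryTheory.Limits CategoryTheory.Pretriangulated

section DC
universe w v u
variable {A : Type u} [Category.{v} A] [Abelian A] [HasDerivedCategory.{w} A]
open DerivedCategory

local notation "HH" => DerivedCategory.homologyFunctor A

section
variable {X Y Z : DerivedCategory A} {f : X ⟶ Y} {g : Y ⟶ Z} {h : Z ⟶ X⟦(1 : ℤ)⟧}

lemma H_zero₂ (hT : Triangle.mk f g h ∈ distTriang (DerivedCategory A)) (n : ℤ)
    (h1 : IsZero ((HH n).obj X)) (h3 : IsZero ((HH n).obj Z)) : IsZero ((HH n).obj Y) :=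
  (HomologySequence.exact₂ _ hT n).isZero_X₂ (h1.eq_of_src _ _) (h3.eq_of_tgt _ _)

lemma H_zero₁ (hT : Triangle.mk f g h ∈ distTriang (DerivedCategory A)) (m n : ℤ) (hmn : m + 1 = n)
    (h3 : IsZero ((HH m).obj Z)) (h2 : IsZero ((HH n).obj Y)) : IsZero ((HH n).obj X) :=
  (HomologySequence.exact₁ _ hT m n hmn).isZero_X₂ (h3.eq_of_src _ _) (h2.eq_of_tgt _ _)

lemma H_zero₃ (hT : Triangle.mk f g h ∈ distTriang (DerivedCategory A)) (m n : ℤ) (hmn : m + 1 = n)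
    (h2 : IsZero ((HH m).obj Y)) (h1 : IsZero ((HH n).obj X)) : IsZero ((HH m).obj Z) :=
  (HomologySequence.exact₃ _ hT m n hmn).isZero_X₂ (h2.eq_of_src _ _) (h1.eq_of_tgt _ _)

lemma H_iso₁ (hT : Triangle.mk f g h ∈ distTriang (DerivedCategory A)) (m n : ℤ) (hmn : m + 1 = n)
    (h1 : IsZero ((HH m).obj Z)) (h3 : IsZero ((HH n).obj Z)) : IsIso ((HH n).map f) := by
  have : Epi ((HH n).map f) :=
    (HomologySequence.epi_homologyMap_mor₁_iff _ hT n).2 (h3.eq_of_tgt _ _)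
  have : Mono ((HH n).map f) :=
    (HomologySequence.mono_homologyMap_mor₁_iff _ hT m n hmn).2 (h1.eq_of_src _ _)
  exact isIso_of_mono_of_epi _

lemma H_iso₂ (hT : Triangle.mk f g h ∈ distTriang (DerivedCategory A)) (m n : ℤ) (hmn : m + 1 = n)
    (h1 : IsZero ((HH m).obj X)) (h3 : IsZero ((HH n).obj X)) : IsIso ((HH m).map g) := by
  have : Epi ((HH m).map g) :=
    (HomologySequence.epi_homologyMap_mor₂_iff _ hT m n hmn).2 (h3.eq_of_tgt _ _)
  have : Mono ((HH m).map g) :=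
    (HomologySequence.mono_homologyMap_mor₂_iff _ hT m).2 (h1.eq_of_src _ _)
  exact isIso_of_mono_of_epi _
end

lemma exTri (X : DerivedCategory A) (m n : ℤ) (hmn : m + 1 = n) :
    ∃ (L G : DerivedCategory A) (f : L ⟶ X) (g : X ⟶ G) (h : G ⟶ L⟦(1 : ℤ)⟧),
      Triangle.mk f g h ∈ distTriang (DerivedCategory A) ∧ L.IsLE m ∧ G.IsGE n := by
  obtain ⟨L, G, hL, hG, f, g, h, hT⟩ := TStructure.t.exists_triangle X m n hmn
  exact ⟨L, G, f, g, h, hT, ⟨hL⟩, ⟨hG⟩⟩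

lemma single_H_bij (P N : A) (φ : (HH 0).obj ((singleFunctor A 0).obj P) ⟶
    (HH 0).obj ((singleFunctor A 0).obj N)) :
    ∃ f, (HH 0).map f = φ := by
  let e := singleFunctorCompHomologyFunctorIso A 0
  refine ⟨(singleFunctor A 0).map (e.inv.app P ≫ φ ≫ e.hom.app N), ?_⟩
  have := e.hom.naturality (e.inv.app P ≫ φ ≫ e.hom.app N)
  rw [← cancel_mono (e.hom.app N)]
  refine this.trans ?_
  simp

lemma single_H_inj (P N : A) (f : (singleFunctor A 0).obj P ⟶ (singleFunctor A 0).obj N)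
    (hf : (HH 0).map f = 0) : f = 0 := by
  obtain ⟨f, rfl⟩ := (singleFunctor A 0).map_surjective f
  let e := singleFunctorCompHomologyFunctorIso A 0
  have := e.inv.naturality f
  dsimp at this
  rw [hf, comp_zero] at this
  have h2 : f = 0 := by
    rw [← cancel_mono (e.inv.app N), zero_comp]
    exact this
  rw [h2, Functor.map_zero]

/-- `H⁰` is bijective on `Hom(X,Y)`. -/
structure HBij (X Y : DerivedCategory A) : Prop where
  surj : ∀ φ : (HH 0).obj X ⟶ (HH 0).obj Y, ∃ f, (HH 0).map f = φ
  inj : ∀ f : X ⟶ Y, (HH 0).map f = 0 → f = 0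

lemma HBij.of_iso {X X' Y Y' : DerivedCategory A} (h : HBij X Y) (e : X ≅ X') (e' : Y ≅ Y') :
    HBij X' Y' where
  surj φ := by
    obtain ⟨f, hf⟩ := h.surj ((HH 0).map e.hom ≫ φ ≫ (HH 0).map e'.inv)
    refine ⟨e.inv ≫ f ≫ e'.hom, ?_⟩
    simp [hf]
  inj f hf := by
    have := h.inj (e.hom ≫ f ≫ e'.inv) (by simp [hf])
    rw [← cancel_epi e.hom, ← cancel_mono e'.inv]
    simpa using this

lemma hBij_heart (X Y : DerivedCategory A) [X.IsLE 0] [X.IsGE 0] [Y.IsLE 0] [Y.IsGE 0] :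
    HBij X Y := by
  obtain ⟨P, ⟨e⟩⟩ := X.exists_iso_singleFunctor_obj_of_isGE_of_isLE 0
  obtain ⟨N, ⟨e'⟩⟩ := Y.exists_iso_singleFunctor_obj_of_isGE_of_isLE 0
  exact HBij.of_iso ⟨single_H_bij P N, single_H_inj P N⟩ e.symm e'.symm

lemma hBij_proj (X Y : DerivedCategory A) [X.IsLE 0] [X.IsGE 0]
    (hX : ∀ (Z : DerivedCategory A), Z.IsLE (-1) → ∀ f : X ⟶ Z, f = 0) : HBij X Y := by
  have stepB : ∀ Y : DerivedCategory A, Y.IsGE 0 → HBij X Y := by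
    intro Y hY
    obtain ⟨L, G, f, g, h, hT, hL, hG⟩ := exTri Y 0 1 (by simp)
    have : L.IsGE 0 := by
      rw [isGE_iff]
      intro i hi
      exact H_zero₁ hT (i - 1) i (by ring) (G.isZero_of_isGE 1 _ (by linarith)) (Y.isZero_of_isGE 0 _ hi)
    have := H_iso₁ hT (-1) 0 (by simp) (G.isZero_of_isGE 1 _ (by simp)) (G.isZero_of_isGE 1 _ (by simp))
    have hb := hBij_heart X L
    constructor
    · intro φ
      obtain ⟨f', hf'⟩ := hb.surj (φ ≫ inv ((HH 0).map f))
      exact ⟨f' ≫ f, by simp [hf']⟩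
    · intro q hq
      obtain ⟨q', rfl⟩ := co2 hT q (TStructure.t.zero _ 0 1)
      rw [hb.inj q', zero_comp]
      rw [← cancel_mono ((HH 0).map f), ← Functor.map_comp, hq, zero_comp]
  obtain ⟨L, G, f, g, h, hT, hL, hG⟩ := exTri Y (-1) 0 (by simp)
  have := H_iso₂ hT 0 1 (by simp) (L.isZero_of_isLE (-1) _ (by simp)) (L.isZero_of_isLE (-1) _ (by simp))
  have hb := stepB G hG
  have : L⟦(1 : ℤ)⟧.IsLE (-2) := TStructure.t.isLE_shift L (-1) 1 (-2)
  have : L⟦(1 : ℤ)⟧.IsLE (-1) := TStructure.t.isLE_of_le _ (-2) (-1)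
  constructor
  · intro φ
    obtain ⟨f', hf'⟩ := hb.surj (φ ≫ (HH 0).map g)
    obtain ⟨q, hq⟩ := co3 hT f' (hX _ inferInstance _)
    refine ⟨q, ?_⟩
    rw [← cancel_mono ((HH 0).map g), ← Functor.map_comp, ← hf', hq]
  · intro q hq
    obtain ⟨q', rfl⟩ := co2 hT q (hb.inj _ (by rw [Functor.map_comp, hq, zero_comp]))
    rw [hX _ inferInstance q', zero_comp]

lemma hBij_inj (X Y : DerivedCategory A) [Y.IsLE 0] [Y.IsGE 0]
    (hY : ∀ (Z : DerivedCategory A), Z.IsGE 1 → ∀ f : Z ⟶ Y, f = 0) : HBij X Y := by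
  have stepB : ∀ X : DerivedCategory A, X.IsLE 0 → HBij X Y := by
    intro X hX
    obtain ⟨L, G, f, g, h, hT, hL, hG⟩ := exTri X (-1) 0 (by simp)
    have : G.IsLE 0 := by
      rw [isLE_iff]
      intro i hi
      exact H_zero₃ hT i (i + 1) (by ring) (X.isZero_of_isLE 0 _ hi) (L.isZero_of_isLE (-1) _ (by linarith))
    have := H_iso₂ hT 0 1 (by simp) (L.isZero_of_isLE (-1) _ (by simp)) (L.isZero_of_isLE (-1) _ (by simp))
    have hb := hBij_heart G Y
    constructor
    · intro φ
      obtain ⟨f', hf'⟩ := hb.surj (inv ((HH 0).map g) ≫ φ)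
      exact ⟨g ≫ f', by simp [hf']⟩
    · intro q hq
      obtain ⟨q', rfl⟩ := yo2 hT q (TStructure.t.zero _ (-1) 0)
      rw [hb.inj q', comp_zero]
      rw [← cancel_epi ((HH 0).map g), ← Functor.map_comp, hq, comp_zero]
  obtain ⟨L, G, f, g, h, hT, hL, hG⟩ := exTri X 0 1 (by simp)
  have := H_iso₁ hT (-1) 0 (by simp) (G.isZero_of_isGE 1 _ (by simp)) (G.isZero_of_isGE 1 _ (by simp))
  have hb := stepB L hL
  have : G⟦(-1 : ℤ)⟧.IsGE 2 := TStructure.t.isGE_shift G 1 (-1) 2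
  have : G⟦(-1 : ℤ)⟧.IsGE 1 := TStructure.t.isGE_of_ge _ 1 2
  have hT' := inv_rot_of_distTriang _ hT
  constructor
  · intro φ
    obtain ⟨f', hf'⟩ := hb.surj ((HH 0).map f ≫ φ)
    obtain ⟨q, hq⟩ : ∃ q : X ⟶ Y, f' = f ≫ q := yo2 hT' f' (hY _ (by assumption) _)
    refine ⟨q, ?_⟩
    rw [← cancel_epi ((HH 0).map f), ← Functor.map_comp, ← hf', hq]
  · intro q hq
    obtain ⟨q', rfl⟩ := yo2 hT q (hb.inj _ (by rw [Functor.map_comp, hq, comp_zero]))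
    rw [hY _ (by assumption) q', comp_zero]

lemma Qh_Q_zero {K L : CochainComplex A ℤ} (f : Q.obj K ⟶ Q.obj L)
    (hs : ∃ g, DerivedCategory.Qh.map (X := (HomotopyCategory.quotient _ _).obj K)
      (Y := (HomotopyCategory.quotient _ _).obj L) g =
      (quotientCompQhIso A).hom.app K ≫ f ≫ (quotientCompQhIso A).inv.app L)
    (h0 : ∀ g : K ⟶ L, g = 0) : f = 0 := by
  obtain ⟨g, hg⟩ := hs
  obtain ⟨g, rfl⟩ := (HomotopyCategory.quotient _ _).map_surjective g
  rw [h0 g, Functor.map_zero, Functor.map_zero] at hg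
  rw [← cancel_epi ((quotientCompQhIso A).hom.app K), ← cancel_mono ((quotientCompQhIso A).inv.app L)]
  simpa using hg.symm

lemma single_proj_vanish (P : A) [Projective P] (Z : DerivedCategory A) (hZ : Z.IsLE (-1))
    (f : (singleFunctor A 0).obj P ⟶ Z) : f = 0 := by
  obtain ⟨L, hL, ⟨e⟩⟩ := Z.exists_iso_Q_obj_of_isLE (-1)
  let e' := (singleFunctorIsoCompQ A 0).app P
  let S := (CochainComplex.singleFunctor A 0).obj P
  have : S.IsKProjective := by
    have : ∀ n, Projective (S.X n) := by
      intro n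
      by_cases hn : n = 0
      · subst hn
        exact Projective.of_iso (HomologicalComplex.singleObjXSelf _ _ P).symm inferInstance
      · exact (HomologicalComplex.isZero_single_obj_X _ _ _ _ hn).projective
    have : S.IsStrictlyLE 0 := by dsimp [S]; infer_instance
    exact CochainComplex.isKProjective_of_projective S 0
  have := Qh_Q_zero (K := S) (e'.inv ≫ f ≫ e.hom)
    ((CochainComplex.IsKProjective.Qh_map_bijective _ _).2 _) (fun g => by
      ext1 n
      by_cases hn : n ≤ -1
      · exact (HomologicalComplex.isZero_single_obj_X _ _ _ _ (by rintro rfl; simp at hn)).eq_of_src _ _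
      · exact (L.isZero_of_isStrictlyLE (-1) n (by omega)).eq_of_tgt _ _)
  rw [← cancel_epi e'.inv, ← cancel_mono e.hom]
  simpa using this

lemma single_inj_vanish (I : A) [Injective I] (Z : DerivedCategory A) (hZ : Z.IsGE 1)
    (f : Z ⟶ (singleFunctor A 0).obj I) : f = 0 := by
  obtain ⟨L, hL, ⟨e⟩⟩ := Z.exists_iso_Q_obj_of_isGE 1
  let e' := (singleFunctorIsoCompQ A 0).app I
  let S := (CochainComplex.singleFunctor A 0).obj I
  have : S.IsKInjective := by
    have : ∀ n, Injective (S.X n) := by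
      intro n
      by_cases hn : n = 0
      · subst hn
        exact Injective.of_iso (HomologicalComplex.singleObjXSelf _ _ I).symm inferInstance
      · exact (HomologicalComplex.isZero_single_obj_X _ _ _ _ hn).injective
    have : S.IsStrictlyGE 0 := by dsimp [S]; infer_instance
    exact CochainComplex.isKInjective_of_injective S 0
  have := Qh_Q_zero (L := S) (e.inv ≫ f ≫ e'.hom)
    ((CochainComplex.IsKInjective.Qh_map_bijective _ _).2 _) (fun g => by
      ext1 n
      by_cases hn : 1 ≤ n
      · exact (HomologicalComplex.isZero_single_obj_X _ _ _ _ (by rintro rfl; simp at hn)).eq_of_tgt _ _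
      · exact (L.isZero_of_isStrictlyGE 1 n (by omega)).eq_of_src _ _)
  rw [← cancel_epi e.inv, ← cancel_mono e'.hom]
  simpa using this

lemma hBij_single_proj (P : A) [Projective P] (Y : DerivedCategory A) :
    HBij ((singleFunctor A 0).obj P) Y := hBij_proj _ _ (single_proj_vanish P)

lemma hBij_single_inj (I : A) [Injective I] (X : DerivedCategory A) :
    HBij X ((singleFunctor A 0).obj I) := hBij_inj _ _ (single_inj_vanish I)

end DC
end


section
open CategoryTheory CategoryTheory.Limits CategoryTheory.Pretriangulated

section UR
variable {R : Type} [Ring R] [HasDerivedCategory.{1} (ModuleCat.{0} R)]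
open DerivedCategory
open scoped ZeroObject

noncomputable abbrev HM (n : ℤ) : DMod R ⥤ ModuleCat.{0} R := DerivedCategory.homologyFunctor (ModuleCat.{0} R) n

variable (R) in
/-- The free module of rank one as an object of the derived category. -/
noncomputable def UU : DMod R := (singleFunctor (ModuleCat.{0} R) 0).obj (ModuleCat.of R R)

instance : (UU R).IsLE 0 := by unfold UU; infer_instance
instance : (UU R).IsGE 0 := by unfold UU; infer_instance

instance projR : Projective (ModuleCat.of R R) :=
  (IsProjective.iff_projective (R := R) (P := R)).1 inferInstance

lemma hBij_UU (X : DMod R) : HBij (UU R) X := hBij_single_proj _ X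

variable (R) in
noncomputable def e0iso : (HM 0).obj (UU R) ≅ ModuleCat.of R R :=
  (singleFunctorCompHomologyFunctorIso (ModuleCat.{0} R) 0).app (ModuleCat.of R R)

variable (R) in
noncomputable def e0 : (HM 0).obj (UU R) := (e0iso R).inv.hom (1 : R)

lemma e0_ext {N : ModuleCat.{0} R} {f g : (HM 0).obj (UU R) ⟶ N} (h : f.hom (e0 R) = g.hom (e0 R)) :
    f = g := by
  rw [← cancel_epi (e0iso R).inv]
  ext
  exact h

lemma e0_lift {N : ModuleCat.{0} R} (x : N) : ∃ f : (HM 0).obj (UU R) ⟶ N, f.hom (e0 R) = x := by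
  refine ⟨(e0iso R).hom ≫ ModuleCat.ofHom (LinearMap.toSpanSingleton R N x), ?_⟩
  have : (e0iso R).hom.hom ((e0iso R).inv.hom (1 : R)) = (1 : R) := by
    rw [← LinearMap.comp_apply, ← ModuleCat.hom_comp, (e0iso R).inv_hom_id]; rfl
  change (LinearMap.toSpanSingleton R N x) ((e0iso R).hom.hom ((e0iso R).inv.hom (1 : R))) = x
  rw [this]
  simp

noncomputable def ev (X : DMod R) : (UU R ⟶ X) →+ (HM 0).obj X where
  toFun f := ((HM 0).map f).hom (e0 R)
  map_zero' := by simp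
  map_add' f g := by simp [Functor.map_add]

lemma ev_comp {X Y : DMod R} (f : UU R ⟶ X) (g : X ⟶ Y) : ev Y (f ≫ g) = ((HM 0).map g).hom (ev X f) := by
  simp [ev]

lemma ev_inj (X : DMod R) : Function.Injective (ev X) := by
  rw [injective_iff_map_eq_zero]
  intro f hf
  apply (hBij_UU X).inj
  exact e0_ext (by rw [show ((HM 0).map f).hom (e0 R) = 0 from hf]; simp)

lemma ev_surj (X : DMod R) : Function.Surjective (ev X) := by
  intro x
  obtain ⟨φ, hφ⟩ := e0_lift x
  obtain ⟨f, rfl⟩ := (hBij_UU X).surj φ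
  exact ⟨f, hφ⟩

noncomputable def Hshift (X : DMod R) (n : ℤ) : (HM 0).obj (X⟦n⟧) ≅ (HM n).obj X :=
  ((homologyFunctor (ModuleCat.{0} R) 0).shiftIso n 0 n (by simp)).app X

lemma isZero_H_iff (X : DMod R) (n : ℤ) : IsZero ((HM n).obj X) ↔ ∀ f : UU R ⟶ X⟦n⟧, f = 0 := by
  rw [← (Hshift X n).isZero_iff]
  constructor
  · intro h f
    apply (hBij_UU _).inj
    exact h.eq_of_tgt _ _
  · intro h
    have : Subsingleton ((HM 0).obj (X⟦n⟧)) := by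
      refine subsingleton_of_forall_eq 0 (fun x => ?_)
      obtain ⟨f, rfl⟩ := ev_surj _ x
      rw [h f, map_zero]
    exact ModuleCat.isZero_of_subsingleton _

lemma isLE_iff_UU (X : DMod R) (n : ℤ) : X.IsLE n ↔ ∀ i, n < i → ∀ f : UU R ⟶ X⟦i⟧, f = 0 := by
  rw [isLE_iff]
  exact forall₂_congr fun i _ => isZero_H_iff X i

lemma isGE_iff_UU (X : DMod R) (n : ℤ) : X.IsGE n ↔ ∀ i, i < n → ∀ f : UU R ⟶ X⟦i⟧, f = 0 := by
  rw [isGE_iff]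
  exact forall₂_congr fun i _ => isZero_H_iff X i

lemma UU_zero (n : ℤ) (hn : n ≠ 0) (f : UU R ⟶ (UU R)⟦n⟧) : f = 0 := by
  rcases lt_or_gt_of_ne hn with h | h
  · exact (isGE_iff_UU (UU R) 0).1 inferInstance _ h f
  · exact (isLE_iff_UU (UU R) 0).1 inferInstance _ h f

lemma isZero_of_H (X : DMod R) (h : ∀ n, IsZero ((HM n).obj X)) : IsZero X := by
  have : IsIso (0 : X ⟶ 0) := by
    rw [isIso_iff]
    intro n
    have h0 : IsZero ((HM n).obj (0 : DMod R)) := (HM n).map_isZero (isZero_zero _)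
    exact ⟨0, (h n).eq_of_src _ _, h0.eq_of_src _ _⟩
  exact (isZero_zero _).of_iso (asIso (0 : X ⟶ 0))

/-- Shifting homs. -/
noncomputable def homShift {D : Type*} [Category D] [HasShift D ℤ] [Preadditive D]
  [∀ n : ℤ, (shiftFunctor D n).Additive] (X Y : D) (n : ℤ) : (X⟦n⟧ ⟶ Y) ≃+ (X ⟶ Y⟦-n⟧) :=
  have : (shiftEquiv D n).functor.Additive := inferInstanceAs (shiftFunctor D n).Additive
  (shiftEquiv D n).toAdjunction.homAddEquiv X Y

lemma small_UU (n : ℤ) (X : DMod R) : Small.{0} ((UU R)⟦n⟧ ⟶ X) :=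
  small_of_injective (β := (HM 0).obj (X⟦-n⟧)) (f := fun f => ev _ (homShift _ _ n f))
    ((ev_inj _).comp (homShift (UU R) X n).injective)

lemma gen_UU (X : DMod R) (h : ∀ (n : ℤ) (f : (UU R)⟦n⟧ ⟶ X), f = 0) : IsZero X := by
  refine isZero_of_H X (fun n => (isZero_H_iff X n).2 (fun f => ?_))
  obtain ⟨m, rfl⟩ : ∃ m, n = -m := ⟨-n, by simp⟩
  obtain ⟨f, rfl⟩ := (homShift (UU R) X m).surjective f
  rw [h _ f, map_zero]

end UR
end


section
open CategoryTheory CategoryTheory.Limits CategoryTheory.Pretriangulated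

section UC
variable {R : Type} [Ring R] [HasDerivedCategory.{1} (ModuleCat.{0} R)]
open DerivedCategory

lemma dsum_homology {α : Type} (K : α → CochainComplex (ModuleCat.{0} R) ℤ)
    (x : (dsum K).homology 0) : ∃ (F : Finset α) (y : ∀ a, (K a).homology 0),
      x = ∑ a ∈ F, (HomologicalComplex.homologyMap (dsumι K a) 0).hom (y a) := by
  classical
  obtain ⟨z, rfl⟩ := mcx_surj _ _ x
  let z' : Π₀ a, (K a).X 0 := (dsum K).iCycles 0 z
  have hz : ∀ a, (K a).d 0 1 (z' a) = 0 := fun a => by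
    rw [← dsum_d_apply]
    change DFunLike.coe (F := Π₀ a, (K a).X 1) ((dsum K).d 0 1 ((dsum K).iCycles 0 z)) a = 0
    rw [mcx_d]; rfl
  choose c hc using fun a => mcx_mk (K a) 0 1 (by simp) (z' a) (hz a)
  refine ⟨z'.support, fun a => (K a).homologyπ 0 (c a), ?_⟩
  have h1 : ∀ a, (HomologicalComplex.homologyMap (dsumι K a) 0).hom ((K a).homologyπ 0 (c a)) =
      (dsum K).homologyπ 0 (HomologicalComplex.cyclesMap (dsumι K a) 0 (c a)) := fun a =>
    ConcreteCategory.congr_hom (HomologicalComplex.homologyπ_naturality (dsumι K a) 0) (c a)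
  simp only [h1]
  rw [← map_sum]
  congr 1
  apply mcx_iCycles_inj
  rw [map_sum]
  have h2 : ∀ a, (dsum K).iCycles 0 (HomologicalComplex.cyclesMap (dsumι K a) 0 (c a)) =
      (dsumι K a).f 0 (z' a) := fun a => by
    rw [← hc]
    exact ConcreteCategory.congr_hom (HomologicalComplex.cyclesMap_i (dsumι K a) 0) (c a)
  simp only [h2]
  exact (DFinsupp.sum_single (f := z')).symm

lemma dsum_H {α : Type} (K : α → CochainComplex (ModuleCat.{0} R) ℤ)
    (x : (HM 0).obj (Q.obj (dsum K))) : ∃ (F : Finset α) (y : ∀ a, (HM 0).obj (Q.obj (K a))),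
      x = ∑ a ∈ F, ((HM 0).map (Q.map (dsumι K a))).hom (y a) := by
  let θ := homologyFunctorFactors (ModuleCat.{0} R) 0
  have hθ : ∀ (L : CochainComplex (ModuleCat.{0} R) ℤ) (v : (HM 0).obj (Q.obj L)),
      (θ.inv.app L).hom ((θ.hom.app L).hom v) = v := fun L v => by
    exact ConcreteCategory.congr_hom (θ.hom_inv_id_app L) v
  obtain ⟨F, y, h⟩ := dsum_homology K ((θ.hom.app _).hom x)
  refine ⟨F, fun a => (θ.inv.app (K a)).hom (y a), ?_⟩
  rw [← hθ _ x, h]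
  refine (map_sum (θ.inv.app (dsum K)).hom _ F).trans ?_
  refine Finset.sum_congr rfl fun a _ => ?_
  exact ConcreteCategory.congr_hom (θ.inv.naturality (dsumι K a)) (y a)

lemma UU_cpt0 : Cpt.{0} (UU R) := by
  intro α Y Z i h f
  let K := fun a => Q.objPreimage (Y a)
  let e := fun a => (Q.objObjPreimageIso (Y a)).symm
  have h' := (D_coprod_Q K).of_iso e
  obtain ⟨s, hs⟩ := h.ex _ (fun a => (e a).hom ≫ Q.map (dsumι K a))
  obtain ⟨t, ht⟩ := h'.ex _ i
  have hst : s ≫ t = 𝟙 _ := h.hom_ext fun a => by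
    rw [← Category.assoc, hs, ht, Category.comp_id]
  obtain ⟨F, y, hy⟩ := dsum_H K (ev _ (f ≫ s))
  choose g hg using fun a => ev_surj _ (y a)
  refine ⟨F, fun a => g a ≫ (e a).inv, ?_⟩
  have : f ≫ s = ∑ a ∈ F, g a ≫ Q.map (dsumι K a) := by
    apply ev_inj
    rw [hy, map_sum]
    simp only [ev_comp, hg]
  calc f = (f ≫ s) ≫ t := by rw [Category.assoc, hst, Category.comp_id]
    _ = _ := by
      rw [this, Preadditive.sum_comp]
      refine Finset.sum_congr rfl fun a _ => ?_
      rw [Category.assoc, Category.assoc, ← ht a]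
      simp

lemma UU_cpt1 : Cpt.{1} (UU R) := by
  classical
  intro α Y Z i h f
  let S := {a : α // ¬ IsZero (Y a)}
  have key : ∀ a : S, ∃ (n : ℤ) (g : (UU R)⟦n⟧ ⟶ Y a), g ≠ 0 := by
    intro a
    by_contra! hc
    exact a.2 (gen_UU _ hc)
  choose n g hg using key
  have : Small.{0} S := by
    have : ∀ m : ℤ, Small.{0} ((UU R)⟦m⟧ ⟶ Z) := fun m => small_UU m Z
    refine small_of_injective (β := Σ m : ℤ, ((UU R)⟦m⟧ ⟶ Z)) (f := fun a => ⟨n a, g a ≫ i a⟩) ?_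
    intro a b hab
    by_contra hne
    have hne' : (b : α) ≠ a := fun h => hne (Subtype.ext h.symm)
    have aux : ∀ (p q : Σ m : ℤ, ((UU R)⟦m⟧ ⟶ Z)), p = q → q.2 ≫ h.proj a = 0 → p.2 ≫ h.proj a = 0 := by
      rintro p q rfl h; exact h
    have := aux _ _ hab (by simp [h.i_proj_ne hne'])
    simp only [Category.assoc, h.i_proj, Category.comp_id] at this
    exact hg a this
  let σ := (equivShrink.{0} S).symm
  have h' : IsCoprod (fun a : Shrink.{0} S => Y (σ a)) Z (fun a => i (σ a)) := by
    constructor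
    · intro W φ
      obtain ⟨γ, hγ⟩ := h.ex W (fun a => if ha : ¬ IsZero (Y a) then
        eqToHom (by simp) ≫ φ (σ.symm ⟨a, ha⟩) else 0)
      refine ⟨γ, fun a => ?_⟩
      rw [hγ, dif_pos (σ a).2]
      have aux : ∀ (b : Shrink.{0} S) (hb : b = a) (p : Y (σ a) = Y (σ b)), eqToHom p ≫ φ b = φ a := by
        rintro b rfl p; simp
      exact aux _ (by simp) _
    · intro W γ hγ
      apply h.uniq
      intro a
      by_cases ha : IsZero (Y a)
      · exact ha.eq_of_src _ _
      · have := hγ (σ.symm ⟨a, ha⟩)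
        rwa [σ.apply_symm_apply] at this
  obtain ⟨F, hF⟩ := (UU_cpt0 (R := R)).exists_finset h' f
  have hγ := hF F subset_rfl
  refine ⟨F.map ⟨fun a => (σ a : α), Subtype.val_injective.comp σ.injective⟩,
    fun a => f ≫ h.proj a, ?_⟩
  rw [Finset.sum_map]
  have hpr : ∀ a, h'.proj a = h.proj (σ a) := by
    intro a
    refine h'.hom_ext fun b => ?_
    by_cases hb : b = a
    · subst hb
      rw [h.i_proj]
      exact h'.i_proj b
    · rw [h'.i_proj_ne hb, h.i_proj_ne]
      exact fun hh => hb (σ.injective (Subtype.ext hh))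
  simp only [hpr] at hγ
  exact hγ

end UC
end


section
open CategoryTheory CategoryTheory.Limits CategoryTheory.Pretriangulated

section Lin
universe v u
variable (k : Type) [Field k]
variable {D : Type u} [Category.{v} D] [Preadditive D] [HasZeroObject D] [HasShift D ℤ]
  [∀ n : ℤ, (shiftFunctor D n).Additive] [Pretriangulated D] [Linear k D]

lemma fin_exact {V₁ V₂ V₃ : Type*} [AddCommGroup V₁] [AddCommGroup V₂] [AddCommGroup V₃]
    [Module k V₁] [Module k V₂] [Module k V₃] (f : V₁ →ₗ[k] V₂) (g : V₂ →ₗ[k] V₃)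
    (h : ∀ x, g x = 0 → ∃ y, f y = x) (h1 : Module.Finite k V₁) (h3 : Module.Finite k V₃) :
    Module.Finite k V₂ := by
  have h3' : Module.Finite k (LinearMap.range g) := inferInstance
  have h2' : (LinearMap.ker g).FG := by
    have : (LinearMap.range f).FG := (inferInstance : Module.Finite k (LinearMap.range f)).fg_top |>
      fun _ => by rw [LinearMap.range_eq_map]; exact (Module.Finite.fg_top).map f
    have : Module.Finite k (LinearMap.range f) := inferInstance
    have hle : LinearMap.ker g ≤ LinearMap.range f := fun x hx => h x hx
    have := Submodule.finiteDimensional_of_le hle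
    exact Module.Finite.iff_fg.1 this
  refine ⟨Submodule.fg_of_fg_map_of_fg_inf_ker g ?_ ?_⟩
  · rw [← LinearMap.range_eq_map]
    exact Module.Finite.iff_fg.1 h3'
  · simpa using h2'

/-- finiteness of graded hom spaces -/
def FinH (P Q : D) : Prop := ∀ m : ℤ, Module.Finite k (P⟦m⟧ ⟶ Q)

variable {k}

lemma fin_of_iso {P P' Q Q' : D} (e : P ≅ P') (e' : Q ≅ Q') (h : Module.Finite k (P ⟶ Q)) :
    Module.Finite k (P' ⟶ Q') := by
  refine Module.Finite.of_surjective ((Linear.leftComp k Q' e.inv).comp (Linear.rightComp k P e'.hom)) ?_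
  intro f
  exact ⟨e.hom ≫ f ≫ e'.inv, by simp⟩

lemma fin_shift [∀ n : ℤ, (shiftFunctor D n).Linear k] {P Q : D} (m : ℤ)
    (h : Module.Finite k (P ⟶ Q)) : Module.Finite k (P⟦m⟧ ⟶ Q⟦m⟧) :=
  Module.Finite.of_surjective ((shiftFunctor D m).mapLinearMap k) (shiftFunctor D m).map_surjective

lemma finH_iff [∀ n : ℤ, (shiftFunctor D n).Linear k] {P Q : D} :
    FinH k P Q ↔ ∀ m : ℤ, Module.Finite k (P ⟶ Q⟦m⟧) := by
  constructor
  · intro h m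
    exact fin_of_iso ((shiftEquiv D m).counitIso.app P) (Iso.refl _) (fin_shift m (h (-m)))
  · intro h m
    exact fin_of_iso (Iso.refl _) ((shiftEquiv D m).counitIso.app Q) (fin_shift m (h (-m)))

lemma fin_ext₂ {P : D} {T : Triangle D} (hT : T ∈ distTriang D) (h1 : Module.Finite k (P ⟶ T.obj₁))
    (h3 : Module.Finite k (P ⟶ T.obj₃)) : Module.Finite k (P ⟶ T.obj₂) :=
  fin_exact k (Linear.rightComp k P T.mor₁) (Linear.rightComp k P T.mor₂)
    (fun x hx => by
      obtain ⟨y, hy⟩ := Triangle.coyoneda_exact₂ T hT x hx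
      exact ⟨y, hy.symm⟩) h1 h3

lemma fin_ext₁ {Q : D} {T : Triangle D} (hT : T ∈ distTriang D) (h1 : Module.Finite k (T.obj₁ ⟶ Q))
    (h3 : Module.Finite k (T.obj₃ ⟶ Q)) : Module.Finite k (T.obj₂ ⟶ Q) :=
  fin_exact k (Linear.leftComp k Q T.mor₂) (Linear.leftComp k Q T.mor₁)
    (fun x hx => by
      obtain ⟨y, hy⟩ := Triangle.yoneda_exact₂ T hT x hx
      exact ⟨y, hy.symm⟩) h3 h1

lemma isThick_finH_right [∀ n : ℤ, (shiftFunctor D n).Linear k] (P : D) :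
    IsThick (fun Q => FinH k P Q) where
  ret X Y r h m := by
    have := h m
    refine Module.Finite.of_surjective (Linear.rightComp k (P⟦m⟧) r.r) fun f => ⟨f ≫ r.i, by simp⟩
  shift X n h := by
    rw [finH_iff] at h ⊢
    intro m
    exact fin_of_iso (Iso.refl _) ((shiftFunctorAdd D n m).app X) (h (n + m))
  ext T hT h1 h3 m := fin_ext₂ hT (h1 m) (h3 m)

lemma isThick_finH_left [∀ n : ℤ, (shiftFunctor D n).Linear k] (Q : D) :
    IsThick (fun P => FinH k P Q) where
  ret X Y r h := by
    rw [finH_iff] at h ⊢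
    intro m
    have := h m
    refine Module.Finite.of_surjective (Linear.leftComp k (Q⟦m⟧) r.i) fun f => ⟨r.r ≫ f, by simp⟩
  shift X n h m := fin_of_iso ((shiftFunctorAdd D n m).app X) (Iso.refl _) (h (n + m))
  ext T hT h1 h3 := by
    rw [finH_iff] at h1 h3 ⊢
    intro m
    exact fin_ext₁ hT (h1 m) (h3 m)

lemma IsThick.comap {D' : Type*} [Category D'] [Preadditive D'] [HasZeroObject D'] [HasShift D' ℤ]
    [∀ n : ℤ, (shiftFunctor D' n).Additive] [Pretriangulated D'] (F : D' ⥤ D)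
    (hF : IsTriangleFunctor F) {Q : D → Prop} (hQ : IsThick Q) : IsThick (fun X => Q (F.obj X)) := by
  obtain ⟨c, hc⟩ := hF
  exact {
    ret := fun X Y r h => hQ.ret _ _ (r.map F) h
    shift := fun X n h => hQ.iso ((F.commShiftIso n).app X).symm (hQ.shift _ n h)
    ext := fun T hT h1 h3 => hQ.ext (F.mapTriangle.obj T) (F.map_distinguished T hT) h1 h3 }

end Lin
end


section
open CategoryTheory CategoryTheory.Limits CategoryTheory.Pretriangulated

lemma fin_full {k : Type*} [Field k] {C D : Type*} [Category C] [Category D] [Preadditive C] [Preadditive D]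
    [Linear k C] [Linear k D] (F : C ⥤ D) [F.Additive] [F.Linear k] [F.Full] {X Y : C}
    (h : Module.Finite k (X ⟶ Y)) : Module.Finite k (F.obj X ⟶ F.obj Y) :=
  Module.Finite.of_surjective (F.mapLinearMap k) F.map_surjective

lemma finHom_of {k : Type*} [Field k] {C : Type*} [Category C] [Preadditive C]
    [Linear k C] {X Y : C} {V : Type*} [AddCommGroup V] [Module k V] [Module.Finite k V]
    (t : V → (X ⟶ Y)) (h1 : ∀ a b, t (a + b) = t a + t b) (h2 : ∀ (c : k) a, t (c • a) = c • t a)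
    (h3 : Function.Surjective t) : Module.Finite k (X ⟶ Y) :=
  Module.Finite.of_surjective (⟨⟨t, h1⟩, h2⟩ : V →ₗ[k] (X ⟶ Y)) h3

section TU
variable {R : Type} [Ring R] [HasDerivedCategory.{1} (ModuleCat.{0} R)]
open DerivedCategory

lemma thick_UU_of_cpt {P : DMod R} (hP : Cpt.{0} P) : thick (UU R) P :=
  neeman D_coprod (UU R) UU_cpt0 small_UU gen_UU P hP

lemma cpt1_of_thick {P : DMod R} (hP : thick (UU R) P) : Cpt.{1} P :=
  thick_induction isThick_cpt UU_cpt1 hP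

lemma thick_LE {P : DMod R} (hP : thick (UU R) P) : ∃ N : ℤ, P.IsLE N := by
  refine thick_induction (Q := fun P : DMod R => ∃ N : ℤ, P.IsLE N) ?_ ⟨0, inferInstance⟩ hP
  constructor
  · rintro X Y r ⟨N, hN⟩
    refine ⟨N, (isLE_iff_UU _ _).2 fun i hi f => ?_⟩
    have := (isLE_iff_UU _ _).1 hN i hi (f ≫ r.i⟦i⟧')
    calc f = (f ≫ r.i⟦i⟧') ≫ r.r⟦i⟧' := by simp [← Functor.map_comp]
      _ = 0 := by rw [this, zero_comp]
  · rintro X n ⟨N, hN⟩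
    exact ⟨N - n, TStructure.t.isLE_shift X N n (N - n)⟩
  · rintro T hT ⟨N, hN⟩ ⟨N', hN'⟩
    refine ⟨max N N', ?_⟩
    rw [isLE_iff]
    intro i hi
    have h1 : N < i := lt_of_le_of_lt (le_max_left _ _) hi
    have h2 : N' < i := lt_of_le_of_lt (le_max_right _ _) hi
    exact H_zero₂ (f := T.mor₁) (g := T.mor₂) (h := T.mor₃) hT i (isZero_of_isLE _ N i h1) (isZero_of_isLE _ N' i h2)

lemma thick_proj {P : DMod R} (hP : thick (UU R) P) :
    ∃ N : ℤ, ∀ Z : DMod R, Z.IsLE N → ∀ f : P ⟶ Z, f = 0 := by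
  refine thick_induction (Q := fun P : DMod R => ∃ N : ℤ, ∀ Z : DMod R, Z.IsLE N → ∀ f : P ⟶ Z, f = 0)
    ?_ ⟨-1, fun Z hZ f => single_proj_vanish _ Z hZ f⟩ hP
  constructor
  · rintro X Y r ⟨N, hN⟩
    refine ⟨N, fun Z hZ f => ?_⟩
    have := hN Z hZ (r.r ≫ f)
    calc f = r.i ≫ (r.r ≫ f) := by simp
      _ = 0 := by rw [this, comp_zero]
  · rintro X n ⟨N, hN⟩
    refine ⟨N - n, fun Z hZ f => ?_⟩
    apply (homShift X Z n).injective
    rw [map_zero]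
    exact hN _ (TStructure.t.isLE_shift Z (N - n) (-n) N) _
  · rintro T hT ⟨N, hN⟩ ⟨N', hN'⟩
    refine ⟨min N N', fun Z hZ f => ?_⟩
    obtain ⟨q, rfl⟩ := Triangle.yoneda_exact₂ T hT f (hN Z (TStructure.t.isLE_of_le Z (min N N') N (min_le_left _ _)) _)
    rw [hN' Z (TStructure.t.isLE_of_le Z (min N N') N' (min_le_right _ _)) q, comp_zero]

open scoped ModuleCat.Algebra

lemma fin_UU (k : Type) [Field k] [Algebra k R] [Module.Finite k R] : FinH k (UU R) (UU R) := by
  rw [finH_iff]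
  intro m
  by_cases hm : m = 0
  · subst hm
    refine fin_of_iso (P := UU R) (Q := UU R) (Iso.refl _) ((shiftFunctorZero (DMod R) ℤ).symm.app _) ?_
    have := finHom_of (k := k) (C := ModuleCat.{0} R) (X := ModuleCat.of R R) (Y := ModuleCat.of R R) (V := R)
      (fun r => ModuleCat.ofHom (LinearMap.toSpanSingleton R R r))
      (fun a b => by ext; simp)
      (fun c a => by
        ext
        change (1 : R) • (c • a) = algebraMap k R c • ((1 : R) • a)
        simp [Algebra.smul_def])
      (fun f => ⟨f.hom (1 : R), by ext; simp⟩)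
    exact fin_full (singleFunctor (ModuleCat.{0} R) 0) this
  · have : Subsingleton (UU R ⟶ (UU R)⟦m⟧) := subsingleton_of_forall_eq 0 (UU_zero m hm)
    infer_instance

lemma fin_thick (k : Type) [Field k] [Algebra k R] [Module.Finite k R] {P Q : DMod R}
    (hP : thick (UU R) P) (hQ : thick (UU R) Q) : FinH k P Q :=
  thick_induction (isThick_finH_left (k := k) Q)
    (thick_induction (isThick_finH_right (k := k) (UU R)) (fin_UU k) hQ) hP

end TU
end


section
open CategoryTheory CategoryTheory.Limits CategoryTheory.Pretriangulated

section Gen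
universe v u v' u'
variable {D : Type u} [Category.{v} D] [Preadditive D] [HasZeroObject D] [HasShift D ℤ]
  [∀ n : ℤ, (shiftFunctor D n).Additive] [Pretriangulated D]
variable {D' : Type u'} [Category.{v'} D'] [Preadditive D'] [HasZeroObject D'] [HasShift D' ℤ]
  [∀ n : ℤ, (shiftFunctor D' n).Additive] [Pretriangulated D']

lemma IsTriangleFunctor.additive {F : D ⥤ D'} (hF : IsTriangleFunctor F) : F.Additive := by
  obtain ⟨c, hc⟩ := hF
  infer_instance

lemma IsTriangleFunctor.exIso {F : D ⥤ D'} (hF : IsTriangleFunctor F) (n : ℤ) (X : D) :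
    Nonempty (F.obj (X⟦n⟧) ≅ (F.obj X)⟦n⟧) := by
  obtain ⟨c, hc⟩ := hF
  exact ⟨(F.commShiftIso n).app X⟩

lemma IsTriangleFunctor.tri {F : D ⥤ D'} (hF : IsTriangleFunctor F) {X Y Z : D} {f : X ⟶ Y} {g : Y ⟶ Z}
    {h : Z ⟶ X⟦(1 : ℤ)⟧} (hT : Triangle.mk f g h ∈ distTriang D) :
    ∃ h' : F.obj Z ⟶ (F.obj X)⟦(1 : ℤ)⟧, Triangle.mk (F.map f) (F.map g) h' ∈ distTriang D' := by
  obtain ⟨c, hc⟩ := hF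
  exact ⟨_, F.map_distinguished _ hT⟩

lemma vanish_iso {X X' Y Y' : D} (e : X ≅ X') (e' : Y ≅ Y') (h : ∀ f : X ⟶ Y, f = 0) (f : X' ⟶ Y') : f = 0 := by
  have := h (e.hom ≫ f ≫ e'.inv)
  rw [← cancel_epi e.hom, ← cancel_mono e'.inv]
  simpa using this

lemma cpt_adj₃ {F : D ⥤ D'} {G : D' ⥤ D} {H : D ⥤ D'} (adj : F ⊣ G) (adj' : G ⊣ H)
    (hF : IsTriangleFunctor F) {X : D} (hX : Cpt.{0} X) : Cpt.{0} (F.obj X) := by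
  have := hF.additive
  exact hX.map_leftAdjoint adj (fun α Y Z i h => h.map_leftAdjoint adj')

/-- `Hom(P, Q)` is finitely generated over `End P`. -/
def FGH (P Q : D) : Prop := ∃ (r : ℕ) (y : Fin r → (P ⟶ Q)), ∀ f : P ⟶ Q, ∃ θ : Fin r → (P ⟶ P),
  f = ∑ i, θ i ≫ y i

lemma fgh_of_fin {k : Type} [Field k] [Linear k D] {P Q : D} (h : Module.Finite k (P ⟶ Q)) : FGH P Q := by
  obtain ⟨r, y, hy⟩ := Module.Finite.exists_fin (R := k) (M := P ⟶ Q)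
  refine ⟨r, y, fun f => ?_⟩
  have hf : f ∈ Submodule.span k (Set.range y) := by rw [hy]; trivial
  obtain ⟨c, hc⟩ := (Submodule.mem_span_range_iff_exists_fun k).1 hf
  exact ⟨fun i => c i • 𝟙 P, by simp [← hc]⟩

lemma FGH.iso {P Q P' Q' : D} (h : FGH P Q) (e : P ≅ P') (e' : Q ≅ Q') : FGH P' Q' := by
  obtain ⟨r, y, hy⟩ := h
  refine ⟨r, fun i => e.inv ≫ y i ≫ e'.hom, fun f => ?_⟩
  obtain ⟨θ, hθ⟩ := hy (e.hom ≫ f ≫ e'.inv)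
  refine ⟨fun i => e.inv ≫ θ i ≫ e.hom, ?_⟩
  rw [← cancel_epi e.hom, ← cancel_mono e'.inv, Category.assoc, hθ]
  simp [Preadditive.comp_sum, Preadditive.sum_comp]

lemma FGH.of_map (F : D ⥤ D') [F.Additive] [F.Full] [F.Faithful] {P Q : D} (h : FGH (F.obj P) (F.obj Q)) :
    FGH P Q := by
  obtain ⟨r, y, hy⟩ := h
  refine ⟨r, fun i => F.preimage (y i), fun f => ?_⟩
  obtain ⟨θ, hθ⟩ := hy (F.map f)
  refine ⟨fun i => F.preimage (θ i), F.map_injective ?_⟩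
  rw [hθ, Functor.map_sum]
  simp

lemma exists_V (P W : D) (r : ℕ) (y : Fin r → (P ⟶ W)) : ∃ (V : D) (v : V ⟶ W),
    (∀ i, ∃ q, y i = q ≫ v) ∧ ∀ Q : D → Prop, (∀ Z, IsZero Z → Q Z) →
      (∀ T ∈ distTriang D, Q T.obj₁ → Q T.obj₃ → Q T.obj₂) → Q P → Q V := by
  induction r with
  | zero =>
    obtain ⟨Z, hZ⟩ := HasZeroObject.zero (C := D)
    exact ⟨Z, 0, fun i => i.elim0, fun Q h _ _ => h Z hZ⟩
  | succ r ih =>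
    obtain ⟨V, v, hv, hQ⟩ := ih (fun i => y i.succ)
    refine ⟨V ⊞ P, biprod.desc v (y 0), ?_, ?_⟩
    · intro i
      refine Fin.cases ?_ ?_ i
      · exact ⟨biprod.inr, by simp⟩
      · intro i
        obtain ⟨q, hq⟩ := hv i
        exact ⟨q ≫ biprod.inl, by simp [hq]⟩
    · intro Q h0 h1 h2
      exact h1 _ (binaryBiproductTriangle_distinguished V P) (hQ Q h0 h1 h2) h2

lemma FGH.factor {P W : D} (h : FGH P W) : ∃ (V : D) (v : V ⟶ W),
    (∀ f : P ⟶ W, ∃ q, f = q ≫ v) ∧ ∀ Q : D → Prop, (∀ Z, IsZero Z → Q Z) →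
      (∀ T ∈ distTriang D, Q T.obj₁ → Q T.obj₃ → Q T.obj₂) → Q P → Q V := by
  obtain ⟨r, y, hy⟩ := h
  obtain ⟨V, v, hv, hQ⟩ := exists_V P W r y
  refine ⟨V, v, fun f => ?_, hQ⟩
  obtain ⟨θ, rfl⟩ := hy f
  choose q hq using hv
  refine ⟨∑ i, θ i ≫ q i, ?_⟩
  rw [Preadditive.sum_comp]
  exact Finset.sum_congr rfl fun i _ => by rw [hq, Category.assoc]

open ZeroObject in
lemma IsThick.zero' {Q : D → Prop} (h : IsThick Q) {X : D} (hX : Q X) (Z : D) (hZ : IsZero Z) : Q Z :=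
  h.iso ((isZero_zero D).iso hZ) (h.zero hX)

end Gen

section Rec
open DerivedCategory
variable {A B C : Type} [Ring A] [Ring B] [Ring C] [HasDerivedCategory.{1} (ModuleCat.{0} A)]
  [HasDerivedCategory.{1} (ModuleCat.{0} B)] [HasDerivedCategory.{1} (ModuleCat.{0} C)]

lemma isZero_H_iff' (X : DMod A) (n : ℤ) : IsZero ((HM n).obj X) ↔ ∀ f : (UU A)⟦-n⟧ ⟶ X, f = 0 := by
  rw [isZero_H_iff]
  obtain ⟨m, rfl⟩ : ∃ m, n = -m := ⟨-n, by simp⟩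
  rw [neg_neg]
  constructor
  · intro h f
    apply (homShift (UU A) X m).injective
    rw [h (homShift _ _ _ f), map_zero]
  · intro h f
    obtain ⟨f, rfl⟩ := (homShift (UU A) X m).surjective f
    rw [h f, map_zero]

section
variable {iS : DMod A ⥤ DMod B} {iP : DMod B ⥤ DMod A} {iH : DMod A ⥤ DMod B}

lemma thick_T (adj : iS ⊣ iP) (adj' : iP ⊣ iH) (hS : IsTriangleFunctor iS) : thick (UU B) (iS.obj (UU A)) :=
  thick_UU_of_cpt (cpt_adj₃ adj adj' hS UU_cpt0)

lemma T_thick (adj : iS ⊣ iP) (adj' : iP ⊣ iH) (hS : IsTriangleFunctor iS) (hP : IsTriangleFunctor iP)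
    (hf : iP.Faithful) : thick (iS.obj (UU A)) (UU B) := by
  have := hP.additive
  have := hS.additive
  refine neeman D_coprod _ (cpt_adj₃ adj adj' hS UU_cpt0) ?_ ?_ _ UU_cpt0
  · intro n X
    obtain ⟨e⟩ := hS.exIso n (UU A)
    have := small_UU n (iP.obj X)
    refine small_of_injective (β := ((UU A)⟦n⟧ ⟶ iP.obj X)) (f := fun f => adj.homEquiv _ _ (e.hom ≫ f)) ?_
    intro f g hfg
    simpa using hfg
  · intro X hX
    have : IsZero (iP.obj X) := by
      apply gen_UU
      intro n f
      obtain ⟨e⟩ := hS.exIso n (UU A)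
      apply (adj.homAddEquiv _ _).symm.injective
      rw [map_zero]
      exact vanish_iso e.symm (Iso.refl _) (hX n) _
    rw [IsZero.iff_id_eq_zero] at this ⊢
    apply iP.map_injective
    rw [iP.map_id, this, iP.map_zero]
end

end Rec
end


section
open CategoryTheory CategoryTheory.Limits CategoryTheory.Pretriangulated
open scoped ModuleCat.Algebra

section RecJ
open DerivedCategory
variable {A C : Type} [Ring A] [Ring C] [HasDerivedCategory.{1} (ModuleCat.{0} A)]
  [HasDerivedCategory.{1} (ModuleCat.{0} C)]
variable {jL : DMod C ⥤ DMod A} {jS : DMod A ⥤ DMod C} {jR : DMod C ⥤ DMod A}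

/-- vanishing transfer -/
lemma adj_vanish {D D' : Type*} [Category D] [Category D'] [Preadditive D] [Preadditive D']
    [HasShift D ℤ] [HasShift D' ℤ] [HasZeroObject D] [HasZeroObject D']
    [∀ n : ℤ, (shiftFunctor D n).Additive] [∀ n : ℤ, (shiftFunctor D' n).Additive]
    [Pretriangulated D] [Pretriangulated D'] {F : D ⥤ D'} {G : D' ⥤ D} (adj : F ⊣ G)
    (hG : IsTriangleFunctor G) (hF : IsTriangleFunctor F) (X : D) (Y : D') (n : ℤ)  :
    (∀ f : F.obj X ⟶ Y⟦n⟧, f = 0) ↔ (∀ f : X ⟶ (G.obj Y)⟦n⟧, f = 0) := by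
  have := hF.additive
  obtain ⟨e⟩ := hG.exIso n Y
  constructor
  · intro h
    refine vanish_iso (Iso.refl _) e (fun f => ?_)
    apply (adj.homAddEquiv _ _).symm.injective
    rw [map_zero]
    exact h _
  · intro h f
    apply (adj.homAddEquiv _ _).injective
    rw [map_zero]
    exact vanish_iso (Iso.refl _) e.symm h _

lemma jS_GE (adj : jL ⊣ jS) (hL : IsTriangleFunctor jL) (hS : IsTriangleFunctor jS)
    (hE : thick (UU A) (jL.obj (UU C))) : ∃ c : ℤ, (jS.obj (UU A)).IsGE c := by
  obtain ⟨N, hN⟩ := thick_LE hE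
  refine ⟨-N, ?_⟩
  rw [isGE_iff_UU]
  intro i hi
  rw [← adj_vanish adj hS hL]
  intro f
  have : ((UU A)⟦i⟧).IsGE (-i) := TStructure.t.isGE_shift (UU A) 0 i (-i)
  exact TStructure.t.zero f N (-i) (by omega)

lemma jS_LE (adj : jL ⊣ jS) (hL : IsTriangleFunctor jL) (hS : IsTriangleFunctor jS)
    (hE : thick (UU A) (jL.obj (UU C))) : ∃ c : ℤ, (jS.obj (UU A)).IsLE c := by
  obtain ⟨N, hN⟩ := thick_proj hE
  refine ⟨-N, ?_⟩
  rw [isLE_iff_UU]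
  intro i hi
  rw [← adj_vanish adj hS hL]
  intro f
  have : ((UU A)⟦i⟧).IsLE (-i) := TStructure.t.isLE_shift (UU A) 0 i (-i)
  exact hN _ (TStructure.t.isLE_of_le _ (-i) N (by omega)) f

lemma jfin (k : Type) [Field k] [Algebra k A] [Module.Finite k A] (adj : jL ⊣ jS)
    (hL : IsTriangleFunctor jL) (hS : IsTriangleFunctor jS) (hfull : jL.Full) (hfaith : jL.Faithful)
    (hE : thick (UU A) (jL.obj (UU C))) (c : ℤ) (hc : (jS.obj (UU A)).IsGE c) (n : ℤ) (d : ℕ) :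
    ∀ W : DMod C, W.IsLE (c - n - 1 + d) → FinH k (jL.obj (UU C)) (jL.obj W) →
      Module.Finite k (jL.obj W ⟶ (UU A)⟦n⟧) := by
  have := hL.additive
  induction d with
  | zero =>
    intro W hW _
    have : ∀ f : jL.obj W ⟶ (UU A)⟦n⟧, f = 0 := by
      rw [adj_vanish adj hS hL]
      intro f
      have : ((jS.obj (UU A))⟦n⟧).IsGE (c - n) := TStructure.t.isGE_shift _ c n (c - n)
      exact TStructure.t.zero f (c - n - 1 + (0 : ℕ)) (c - n) (by simp)
    have : Subsingleton (jL.obj W ⟶ (UU A)⟦n⟧) := subsingleton_of_forall_eq 0 this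
    infer_instance
  | succ d ih =>
    intro W hW hfin
    obtain ⟨m, hm⟩ : ∃ m : ℤ, m = c - n - 1 + (d + 1 : ℕ) := ⟨_, rfl⟩
    rw [← hm] at hW
    obtain ⟨e⟩ := hL.exIso (-m) (UU C)
    have hFG : FGH ((UU C)⟦-m⟧) W := FGH.of_map jL ((fgh_of_fin (hfin (-m))).iso e.symm (Iso.refl _))
    obtain ⟨V, v, hv, hQ⟩ := hFG.factor
    have hVLE : V.IsLE m := by
      refine hQ (fun V => V.IsLE m) ?_ ?_ ?_
      · intro Z hZ
        rw [isLE_iff]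
        intro i _
        exact (HM i).map_isZero hZ
      · intro T hT h1 h3
        rw [isLE_iff]
        intro i hi
        exact H_zero₂ (f := T.mor₁) (g := T.mor₂) (h := T.mor₃) hT i
          (isZero_of_isLE _ m i hi) (isZero_of_isLE _ m i hi)
      · exact TStructure.t.isLE_shift _ 0 (-m) m
    have hVthick : thick (UU A) (jL.obj V) := by
      have ht : IsThick (fun X => thick (UU A) (jL.obj X)) := IsThick.comap jL hL (isThick_thick _)
      exact hQ _ (ht.zero' hE) ht.ext (ht.shift _ _ hE)
    obtain ⟨W', g, h, hT⟩ := distinguished_cocone_triangle v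
    obtain ⟨h', hT'⟩ := hL.tri hT
    have hW' : W'.IsLE (c - n - 1 + d) := by
      rw [isLE_iff]
      intro i hi
      by_cases him : i = m
      · subst him
        rw [isZero_H_iff']
        intro f
        have hV1 : (V⟦(1 : ℤ)⟧).IsLE (i - 1) := TStructure.t.isLE_shift _ i 1 (i - 1)
        have h0 : f ≫ h = 0 := (isZero_H_iff' _ i).1 (isZero_of_isLE _ (i - 1) i (by omega)) _
        obtain ⟨q, rfl⟩ := co3 hT f h0
        obtain ⟨q', rfl⟩ := hv q
        rw [Category.assoc, tri12 hT, comp_zero]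
      · have : m < i := by push_cast at hm; omega
        exact H_zero₃ hT i (i + 1) rfl (isZero_of_isLE _ m i this) (isZero_of_isLE _ m _ (by omega))
    have hfin' : FinH k (jL.obj (UU C)) (jL.obj W') :=
      (isThick_finH_right (k := k) (jL.obj (UU C))).ext₃ _ hT' (fin_thick k hE hVthick) hfin
    refine fin_ext₁ hT' ?_ (ih W' hW' hfin')
    exact finH_iff.1 (fin_thick k hVthick (thick_self _)) n

lemma jfin_final (k : Type) [Field k] [Algebra k A] [Module.Finite k A] (adj : jL ⊣ jS)
    (hL : IsTriangleFunctor jL) (hS : IsTriangleFunctor jS) (hfull : jL.Full) (hfaith : jL.Faithful)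
    (hE : thick (UU A) (jL.obj (UU C))) : FinH k (jL.obj (jS.obj (UU A))) (UU A) := by
  have := hL.additive
  rw [finH_iff]
  intro n
  obtain ⟨c, hc⟩ := jS_GE adj hL hS hE
  obtain ⟨m, hm⟩ := jS_LE adj hL hS hE
  refine jfin k adj hL hS hfull hfaith hE c hc n (m - (c - n - 1)).toNat _
    (TStructure.t.isLE_of_le _ m _ (by omega)) ?_
  intro p
  have hf := fin_thick k hE (thick_self (UU A)) p
  let ε : jL.obj (jS.obj (UU A)) ⟶ UU A := adj.counit.app (UU A)
  refine Module.Finite.of_injective (Linear.rightComp k ((jL.obj (UU C))⟦p⟧) ε) ?_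
  rw [injective_iff_map_eq_zero]
  intro q hq
  obtain ⟨e⟩ := hL.exIso p (UU C)
  obtain ⟨q', hq'⟩ := jL.map_surjective (e.hom ≫ q)
  have h0 : q' = 0 := by
    apply (adj.homAddEquiv _ _).symm.injective
    rw [map_zero]
    change jL.map q' ≫ adj.counit.app (UU A) = 0
    rw [hq', Category.assoc]
    change e.hom ≫ (q ≫ adj.counit.app (UU A)) = 0
    rw [show q ≫ adj.counit.app (UU A) = 0 from hq, comp_zero]
  rw [h0, jL.map_zero] at hq'
  rw [← cancel_epi e.hom, ← hq', comp_zero]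

variable {B : Type} [Ring B] [HasDerivedCategory.{1} (ModuleCat.{0} B)]
variable {iS : DMod A ⥤ DMod B} {iP : DMod B ⥤ DMod A} {iH : DMod A ⥤ DMod B}

lemma iB_fin (k : Type) [Field k] [Algebra k A] [Module.Finite k A]
    (tS : IsTriangleFunctor iS) (tP : IsTriangleFunctor iP)
    (tjL : IsTriangleFunctor jL) (tjS : IsTriangleFunctor jS)
    (hrec : IsRecollement iS iP iH jL jS jR) : FinH k (iP.obj (UU B)) (UU A) := by
  obtain ⟨a1, a2, a3, a4, h1, h2, h3, h4, h5, h6, h7, h8, h9⟩ := hrec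
  have hE : thick (UU A) (jL.obj (UU C)) := thick_UU_of_cpt (cpt_adj₃ a3 a4 tjL UU_cpt0)
  have hj := jfin_final k a3 tjL tjS h3 h4 hE
  obtain ⟨w, hT⟩ := h8 (UU A)
  have hi : FinH k (iP.obj (iS.obj (UU A))) (UU A) :=
    (isThick_finH_left (k := k) (UU A)).ext₃ _ hT hj (fin_UU k)
  exact thick_induction (IsThick.comap iP tP (isThick_finH_left (k := k) (UU A))) hi
    (T_thick a1 a2 tS tP h2)

end RecJ
end


section
open CategoryTheory CategoryTheory.Limits CategoryTheory.Pretriangulated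

section InjDim
open DerivedCategory
variable {R : Type} [Ring R]

lemma hasInjDim_of_injDimLE {N : ModuleCat.{0} R} {n : ℕ} (h : InjDimLE R N n) :
    HasInjectiveDimensionLT N (n + 1) := by
  let := HasExt.standard (ModuleCat.{0} R)
  refine HasInjectiveDimensionLT.mk (fun i hi Y e => ?_)
  let P := ProjectiveResolution.of Y
  obtain ⟨i, rfl⟩ : ∃ j, i = j + 1 := ⟨i - 1, by omega⟩
  obtain ⟨f, hf, rfl⟩ := P.extMk_surjective e (i + 2) rfl
  rw [P.extMk_eq_zero_iff _ _ _ _ i rfl]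
  have h0 := (h Y (i + 1) (by omega)).of_iso (P.isoExt (R := ℤ) (i + 1) N).symm
  rw [← HomologicalComplex.exactAt_iff_isZero_homology,
    HomologicalComplex.exactAt_iff' _ i (i + 1) (i + 2) (by simp) (by simp),
    ShortComplex.moduleCat_exact_iff] at h0
  obtain ⟨g, hg⟩ := h0 f hf
  exact ⟨g, hg⟩

variable [HasDerivedCategory.{1} (ModuleCat.{0} R)]

lemma injDim_vanish (n : ℕ) : ∀ N : ModuleCat.{0} R, HasInjectiveDimensionLT N (n + 1) →
    ∀ Y : DMod R, Y.IsGE (n + 1) → ∀ f : Y ⟶ (singleFunctor (ModuleCat.{0} R) 0).obj N, f = 0 := by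
  induction n with
  | zero =>
    intro N hN Y hY f
    have : Injective N := injective_iff_hasInjectiveDimensionLT_one.2 hN
    exact single_inj_vanish N Y (by simpa using hY) f
  | succ n ih =>
    intro N hN Y hY f
    let S : ShortComplex (ModuleCat.{0} R) := ShortComplex.mk (Injective.ι N) (cokernel.π (Injective.ι N)) (by simp)
    have hS : S.ShortExact := { exact := ShortComplex.exact_cokernel _ }
    have hI : Injective S.X₂ := inferInstanceAs (Injective (Injective.under N))
    have h3 : HasInjectiveDimensionLT S.X₃ (n + 1) := hS.hasInjectiveDimensionLT_X₃ (n + 1)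
      (by have := injective_iff_hasInjectiveDimensionLT_one.1 hI
          exact hasInjectiveDimensionLT_of_ge _ 1 (n + 1) (by omega)) hN
    have hT := hS.singleTriangle_distinguished
    have hT' := rot_of_distTriang _ hT
    have hT'' := inv_rot_of_distTriang _ hT
    have hY1 : Y.IsGE 1 := TStructure.t.isGE_of_ge _ 1 ((n + 1 : ℕ) + 1) (by push_cast; omega)
    have h0 : f ≫ (singleFunctor (ModuleCat.{0} R) 0).map (Injective.ι N) = 0 :=
      single_inj_vanish _ Y hY1 _
    obtain ⟨s, rfl⟩ := Triangle.coyoneda_exact₂ _ hT'' f h0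
    have hs : s = 0 := by
      have := ih S.X₃ h3 (Y⟦(1 : ℤ)⟧) (TStructure.t.isGE_shift Y ((n + 1 : ℕ) + 1) 1 _ (by push_cast; omega))
      have : (homShift Y ((singleFunctor (ModuleCat.{0} R) 0).obj S.X₃) 1).symm s = 0 := this _
      exact (AddEquiv.map_eq_zero_iff _).1 this
    rw [hs]
    exact zero_comp
end InjDim
end


section
open CategoryTheory CategoryTheory.Limits CategoryTheory.Pretriangulated
open scoped ModuleCat.Algebra

section RecX
open DerivedCategory
variable {A B C : Type} [Ring A] [Ring B] [Ring C] [HasDerivedCategory.{1} (ModuleCat.{0} A)]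
  [HasDerivedCategory.{1} (ModuleCat.{0} B)] [HasDerivedCategory.{1} (ModuleCat.{0} C)]
variable {iS : DMod A ⥤ DMod B} {iP : DMod B ⥤ DMod A} {iH : DMod A ⥤ DMod B}

lemma X_fgh (k : Type) [Field k] [Algebra k A] (tP : IsTriangleFunctor iP) (tH : IsTriangleFunctor iH)
    (adj : iP ⊣ iH) (hf : iP.Full) (hfin : FinH k (iP.obj (UU B)) (UU A)) (n : ℤ) :
    FGH (UU B) ((iH.obj (UU A))⟦n⟧) := by
  have := tP.additive
  obtain ⟨e⟩ := tH.exIso n (UU A)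
  refine FGH.iso ?_ (Iso.refl _) e
  obtain ⟨r, y, hy⟩ := fgh_of_fin (finH_iff.1 hfin n)
  refine ⟨r, fun i => adj.homAddEquiv _ _ (y i), fun f => ?_⟩
  obtain ⟨θ, hθ⟩ := hy ((adj.homAddEquiv _ _).symm f)
  refine ⟨fun i => iP.preimage (θ i), ?_⟩
  apply (adj.homAddEquiv _ _).symm.injective
  rw [hθ, map_sum]
  refine Finset.sum_congr rfl fun i _ => ?_
  apply (adj.homAddEquiv _ _).injective
  rw [AddEquiv.apply_symm_apply]
  have := adj.homEquiv_naturality_left (iP.preimage (θ i)) (y i)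
  rw [iP.map_preimage] at this
  exact this

lemma X_GE (tS : IsTriangleFunctor iS) (tP : IsTriangleFunctor iP) (tH : IsTriangleFunctor iH)
    (adj : iS ⊣ iP) (adj' : iP ⊣ iH) : ∃ c : ℤ, (iH.obj (UU A)).IsGE c := by
  obtain ⟨c, hc⟩ := jS_LE adj tS tP (thick_T adj adj' tS)
  refine ⟨-c, ?_⟩
  rw [isGE_iff_UU]
  intro i hi
  rw [← adj_vanish adj' tH tP]
  intro f
  have : ((UU A)⟦i⟧).IsGE (-i) := TStructure.t.isGE_shift (UU A) 0 i (-i)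
  exact TStructure.t.zero f c (-i) (by omega)

lemma X_injdim (tS : IsTriangleFunctor iS) (tP : IsTriangleFunctor iP) 
    (adj : iS ⊣ iP) (adj' : iP ⊣ iH) (n : ℕ) (hA : HasInjectiveDimensionLT (ModuleCat.of A A) (n + 1)) :
    ∃ L : ℤ, ∀ Y : DMod B, Y.IsGE L → ∀ f : Y ⟶ iH.obj (UU A), f = 0 := by
  have := tP.additive
  obtain ⟨c, hc⟩ := thick_LE (thick_T adj adj' tS)
  refine ⟨n + 1 + c, fun Y hY f => ?_⟩
  apply (adj'.homAddEquiv _ _).symm.injective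
  rw [map_zero]
  refine injDim_vanish n _ hA (iP.obj Y) ?_ _
  rw [isGE_iff_UU]
  intro i hi
  rw [← adj_vanish adj tP tS]
  intro f
  have : (Y⟦i⟧).IsGE (n + 1 + c - i) := TStructure.t.isGE_shift Y (n + 1 + c) i _
  exact TStructure.t.zero f c (n + 1 + c - i) (by omega)
end RecX
end


section
open CategoryTheory CategoryTheory.Limits CategoryTheory.Pretriangulated
open scoped ModuleCat.Algebra

section Coghost
open DerivedCategory
variable {R : Type} [Ring R] [HasDerivedCategory.{1} (ModuleCat.{0} R)]

lemma fin_of_fgh {k : Type} [Field k] {D : Type*} [Category D] [Preadditive D] [Linear k D] {P Q : D}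
    (h : FGH P Q) (hP : Module.Finite k (P ⟶ P)) : Module.Finite k (P ⟶ Q) := by
  obtain ⟨r, y, hy⟩ := h
  refine finHom_of (V := Fin r → (P ⟶ P)) (fun θ => ∑ i, θ i ≫ y i) ?_ ?_ ?_
  · intro a b
    simp [Finset.sum_add_distrib]
  · intro c a
    simp [Finset.smul_sum]
  · intro f
    obtain ⟨θ, hθ⟩ := hy f
    exact ⟨θ, hθ.symm⟩

lemma H_finite {X : DMod R} (h : FGH (UU R) X) : Module.Finite R ((HM 0).obj X) := by
  classical
  obtain ⟨r, y, hy⟩ := h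
  refine ⟨⟨Finset.univ.image fun i => ev X (y i), ?_⟩⟩
  rw [eq_top_iff]
  intro x _
  obtain ⟨f, rfl⟩ := ev_surj _ x
  obtain ⟨θ, rfl⟩ := hy f
  rw [map_sum]
  refine Submodule.sum_mem _ (fun i _ => ?_)
  rw [ev_comp]
  obtain ⟨c, hc⟩ : ∃ c : R, ev _ (θ i) = c • e0 R := by
    refine ⟨(e0iso R).hom.hom (ev _ (θ i)), ?_⟩
    have h1 : ∀ z, (e0iso R).inv.hom ((e0iso R).hom.hom z) = z := by
      intro z
      rw [← LinearMap.comp_apply, ← ModuleCat.hom_comp, (e0iso R).hom_inv_id]; rfl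
    rw [e0, ← map_smul]
    conv_lhs => rw [← h1 (ev _ (θ i))]
    congr 1
    exact (mul_one (M := R) _).symm
  rw [hc, map_smul]
  apply Submodule.smul_mem
  apply Submodule.subset_span
  simp only [Finset.coe_image, Finset.coe_univ, Set.image_univ]
  exact ⟨i, rfl⟩

variable (R) in
/-- enough finitely generated injectives which are perfect -/
def EnoughPerfInj : Prop := ∀ N : ModuleCat.{0} R, Module.Finite R N → ∃ J : ModuleCat.{0} R,
  Injective J ∧ thick (UU R) ((singleFunctor (ModuleCat.{0} R) 0).obj J) ∧ ∃ f : N ⟶ J, Mono f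

lemma exists_v (hR : EnoughPerfInj R) (X : DMod R) (n : ℤ) (h : FGH (UU R) (X⟦n⟧)) :
    ∃ (J : ModuleCat.{0} R) (v : X ⟶ ((singleFunctor (ModuleCat.{0} R) 0).obj J)⟦-n⟧),
      thick (UU R) ((singleFunctor (ModuleCat.{0} R) 0).obj J) ∧
      ∀ t : (UU R)⟦-n⟧ ⟶ X, t ≫ v = 0 → t = 0 := by
  obtain ⟨J, hJ, hth, φ, hφ⟩ := hR _ (H_finite h)
  let eJ : (HM 0).obj ((singleFunctor (ModuleCat.{0} R) 0).obj J) ≅ J :=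
    (singleFunctorCompHomologyFunctorIso (ModuleCat.{0} R) 0).app J
  obtain ⟨v0, hv0⟩ := (hBij_single_inj J (X⟦n⟧)).surj (φ ≫ eJ.inv)
  have hmono : Mono ((HM 0).map v0) := by
    have : (HM 0).map v0 = φ ≫ eJ.inv := hv0
    rw [this]; infer_instance
  have key : ∀ t : UU R ⟶ X⟦n⟧, t ≫ v0 = 0 → t = 0 := by
    intro t ht
    apply ev_inj
    rw [map_zero]
    have h1 := (ModuleCat.mono_iff_injective ((HM 0).map v0)).1 hmono
    apply h1
    have := ev_comp t v0
    rw [ht, map_zero] at this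
    exact this.symm.trans (map_zero _).symm
  refine ⟨J, homShift _ _ n v0, hth, fun t ht => ?_⟩
  have h1 : t⟦n⟧' ≫ v0 = 0 := by
    apply (homShift _ _ n).injective
    rw [map_zero, ← ht]
    exact (shiftEquiv (DMod R) n).toAdjunction.homEquiv_naturality_left t v0
  let e : ((UU R)⟦-n⟧)⟦n⟧ ≅ UU R := shiftNegShift (UU R) n
  have h2 : e.inv ≫ t⟦n⟧' = 0 := key _ (by rw [Category.assoc, h1, comp_zero])
  have h3 : t⟦n⟧' = 0 := by
    rw [← cancel_epi e.inv, h2, comp_zero]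
  exact (shiftFunctor (DMod R) n).map_injective (by rw [h3, Functor.map_zero])

lemma coghost_step {k : Type} [Field k] [Algebra k R] [Module.Finite k R]
    (hR : EnoughPerfInj R) (X : DMod R) (n : ℤ) (hX : X.IsGE n) (h : FinH k (UU R) X) :
    ∃ (W Z : DMod R) (w : W ⟶ X) (g : X ⟶ Z) (d : Z ⟶ W⟦(1 : ℤ)⟧), Triangle.mk w g d ∈ distTriang _ ∧
      thick (UU R) Z ∧ W.IsGE (n + 1) ∧ FinH k (UU R) W := by
  obtain ⟨J, v, hJ, hv⟩ := exists_v hR X n (fgh_of_fin (finH_iff.1 h n))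
  obtain ⟨W, w, d, hT⟩ := distinguished_cocone_triangle₁ v
  have hth := (isThick_thick (UU R)).shift _ (-n) hJ
  refine ⟨W, _, w, v, d, hT, hth, ?_, ?_⟩
  · have hJGE : (((singleFunctor (ModuleCat.{0} R) 0).obj J)⟦-n⟧).IsGE n :=
      TStructure.t.isGE_shift _ 0 (-n) n
    rw [isGE_iff]
    intro i hi
    by_cases hin : i = n
    · subst hin
      rw [isZero_H_iff']
      intro f
      have h0 : f ≫ w = 0 := hv _ (by rw [Category.assoc, tri12 hT, comp_zero])
      have hT' := inv_rot_of_distTriang _ hT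
      obtain ⟨s, rfl⟩ := Triangle.coyoneda_exact₂ _ hT' f h0
      have hUU : ((UU R)⟦-i⟧).IsLE i := TStructure.t.isLE_shift _ 0 (-i) i
      have hJ' : ((((singleFunctor (ModuleCat.{0} R) 0).obj J)⟦-i⟧)⟦(-1 : ℤ)⟧).IsGE (i + 1) :=
        TStructure.t.isGE_shift _ i (-1) (i + 1)
      have hs : s = 0 := TStructure.t.zero (Y := (((singleFunctor (ModuleCat.{0} R) 0).obj J)⟦-i⟧)⟦(-1 : ℤ)⟧) s i (i + 1) (by omega)
      rw [hs]
      exact zero_comp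
    · exact H_zero₁ hT (i - 1) i (by ring) (isZero_of_isGE _ n _ (by omega)) (isZero_of_isGE _ n _ (by omega))
  · exact (isThick_finH_right (k := k) (UU R)).ext₁ _ hT h (fin_thick k (thick_self _) hth)

lemma coghost {k : Type} [Field k] [Algebra k R] [Module.Finite k R]
    (hR : EnoughPerfInj R) (X : DMod R) (n : ℤ) (hX : X.IsGE n) (h : FinH k (UU R) X) (d : ℕ) :
    ∃ (W Z : DMod R) (w : W ⟶ X) (g : X ⟶ Z) (q : Z ⟶ W⟦(1 : ℤ)⟧), Triangle.mk w g q ∈ distTriang _ ∧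
      thick (UU R) Z ∧ W.IsGE (n + d) ∧ FinH k (UU R) W := by
  induction d with
  | zero =>
    refine ⟨X, _, 𝟙 X, _, _, contractible_distinguished X, ?_, by simpa using hX, h⟩
    exact (isThick_thick (UU R)).zero (thick_self _)
  | succ d ih =>
    obtain ⟨W, Z, w, g, q, hT, hZ, hW, hf⟩ := ih
    obtain ⟨W', Z', w', g', q', hT', hZ', hW', hf'⟩ := coghost_step hR W _ hW hf
    obtain ⟨Z'', g'', q'', hT''⟩ := distinguished_cocone_triangle (w' ≫ w)
    refine ⟨W', Z'', w' ≫ w, g'', q'', hT'', ?_, ?_, hf'⟩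
    · have o := Triangulated.someOctahedron rfl hT' hT hT''
      exact (isThick_thick (UU R)).ext _ o.mem hZ' hZ
    · push_cast
      rwa [← add_assoc]

lemma coghost_final {k : Type} [Field k] [Algebra k R] [Module.Finite k R]
    (hR : EnoughPerfInj R) (X : DMod R) (n : ℤ) (hX : X.IsGE n) (h : FinH k (UU R) X)
    (L : ℤ) (hL : ∀ Y : DMod R, Y.IsGE L → ∀ f : Y ⟶ X, f = 0) : thick (UU R) X := by
  obtain ⟨W, Z, w, g, q, hT, hZ, hW, -⟩ := coghost hR X n hX h (L - n).toNat
  have hw : w = 0 := hL W (TStructure.t.isGE_of_ge _ L (n + (L - n).toNat) (by omega)) w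
  obtain ⟨s, hs⟩ := yo2 hT (𝟙 X) (by rw [hw, zero_comp])
  exact (isThick_thick (UU R)).ret X Z ⟨g, s, hs.symm⟩ hZ
end Coghost
end


section
open CategoryTheory CategoryTheory.Limits CategoryTheory.Pretriangulated

section Dual
variable {k B S : Type} [Field k] [Ring B] [Ring S] [Algebra k B] [Algebra k S]

/-- The `k`-dual of an `S`-module, as a module over `B ≃ Sᵐᵒᵖ`. -/
def Dk (t : B ≃ₐ[k] Sᵐᵒᵖ) (N : Type) [AddCommGroup N] [Module k N] : Type :=
  let _ := t
  N →ₗ[k] k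

variable (t : B ≃ₐ[k] Sᵐᵒᵖ) (N : Type) [AddCommGroup N] [Module k N]

instance : AddCommGroup (Dk t N) := inferInstanceAs (AddCommGroup (N →ₗ[k] k))
instance : Module k (Dk t N) := inferInstanceAs (Module k (N →ₗ[k] k))
instance [Module.Finite k N] : Module.Finite k (Dk t N) := inferInstanceAs (Module.Finite k (N →ₗ[k] k))

variable {t N}
/-- evaluate -/
def Dk.fn (φ : Dk t N) : N →ₗ[k] k := φ
/-- constructor -/
def Dk.of (t : B ≃ₐ[k] Sᵐᵒᵖ) (φ : N →ₗ[k] k) : Dk t N := φ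
@[ext] lemma Dk.ext {φ ψ : Dk t N} (h : ∀ x, φ.fn x = ψ.fn x) : φ = ψ := LinearMap.ext h
@[simp] lemma Dk.fn_of (φ : N →ₗ[k] k) : (Dk.of t φ).fn = φ := rfl
@[simp] lemma Dk.fn_add (φ ψ : Dk t N) : (φ + ψ).fn = φ.fn + ψ.fn := rfl
@[simp] lemma Dk.fn_zero : (0 : Dk t N).fn = 0 := rfl
@[simp] lemma Dk.fn_smul' (c : k) (φ : Dk t N) : (c • φ).fn = c • φ.fn := rfl

variable [Module S N] [IsScalarTower k S N]

instance : SMul B (Dk t N) := ⟨fun b φ => Dk.of t (φ.fn ∘ₗ Algebra.lsmul k k N (t b).unop)⟩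
@[simp] lemma Dk.fn_smul (b : B) (φ : Dk t N) (x : N) : (b • φ).fn x = φ.fn ((t b).unop • x) := rfl

instance : Module B (Dk t N) where
  one_smul φ := by ext x; simp
  mul_smul a b φ := by ext x; simp [mul_smul]
  smul_zero a := by ext x; simp
  smul_add a φ ψ := by ext x; simp
  add_smul a b φ := by ext x; simp [add_smul]
  zero_smul φ := by ext x; simp

instance : IsScalarTower k B (Dk t N) := ⟨fun c b φ => by ext x; simp⟩

variable {N' : Type} [AddCommGroup N'] [Module k N'] [Module S N'] [IsScalarTower k S N']

/-- dual map -/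
def Dk.map (t : B ≃ₐ[k] Sᵐᵒᵖ) (f : N →ₗ[S] N') : Dk t N' →ₗ[B] Dk t N where
  toFun φ := Dk.of t (φ.fn ∘ₗ f.restrictScalars k)
  map_add' φ ψ := by ext x; simp
  map_smul' b φ := by ext x; simp

@[simp] lemma Dk.map_fn (f : N →ₗ[S] N') (φ : Dk t N') (x : N) : (Dk.map t f φ).fn x = φ.fn (f x) := rfl

lemma Dk.map_inj (f : N →ₗ[S] N') (hf : Function.Surjective f) : Function.Injective (Dk.map t f) := by
  intro φ ψ h
  ext x
  obtain ⟨y, rfl⟩ := hf x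
  exact congrArg (fun φ => Dk.fn φ y) h

lemma Dk.map_surj (f : N →ₗ[S] N') (hf : Function.Injective f) : Function.Surjective (Dk.map t f) := by
  intro φ
  obtain ⟨ψ, hψ⟩ := LinearMap.dualMap_surjective_of_injective (f := f.restrictScalars k) hf φ.fn
  refine ⟨Dk.of t ψ, ?_⟩
  ext x
  exact congrArg (fun φ => φ x) hψ

lemma Dk.exact {N'' : Type} [AddCommGroup N''] [Module k N''] [Module S N''] [IsScalarTower k S N'']
    (f : N →ₗ[S] N') (g : N' →ₗ[S] N'') (hg : Function.Surjective g) (h : Function.Exact f g) :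
    Function.Exact (Dk.map t g) (Dk.map t f) := by
  intro φ
  constructor
  · intro h0
    have h1 : ∀ y, g y = 0 → φ.fn y = 0 := by
      intro y hy
      obtain ⟨x, rfl⟩ := (h y).1 hy
      exact congrArg (fun φ => Dk.fn φ x) h0
    obtain ⟨s, hs⟩ := (g.restrictScalars k).exists_rightInverse_of_surjective (LinearMap.range_eq_top.2 hg)
    refine ⟨Dk.of t (φ.fn ∘ₗ s), ?_⟩
    ext y
    have h2 : g (s (g y)) = g y := congrArg (fun φ => φ (g y)) hs
    have := h1 (s (g y) - y) (by rw [map_sub, h2, sub_self])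
    rw [map_sub, sub_eq_zero] at this
    exact this
  · rintro ⟨ψ, rfl⟩
    ext x
    simp [h.apply_apply_eq_zero]

/-- dual of free is injective -/
lemma Dk.injective_free (r : ℕ) {X Y : Type} [AddCommGroup X] [AddCommGroup Y] [Module B X] [Module B Y]
    (f : X →ₗ[B] Y) (hf : Function.Injective f) (g : X →ₗ[B] Dk t (Fin r → S)) :
    ∃ h : Y →ₗ[B] Dk t (Fin r → S), ∀ x, h (f x) = g x := by
  classical
  let : Module k X := Module.compHom X (algebraMap k B)
  let : Module k Y := Module.compHom Y (algebraMap k B)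
  have : IsScalarTower k B X := ⟨fun c b x => by
    rw [Algebra.smul_def, mul_smul]; rfl⟩
  have : IsScalarTower k B Y := ⟨fun c b x => by
    rw [Algebra.smul_def, mul_smul]; rfl⟩
  have key : ∀ i : Fin r, ∃ h : Y →ₗ[k] k, ∀ x, h (f x) = (g x).fn (Pi.single i 1) := by
    intro i
    let gi : X →ₗ[k] k :=
      { toFun := fun x => (g x).fn (Pi.single i 1)
        map_add' := by intro x y; simp
        map_smul' := by
          intro c x
          have : g (c • x) = c • g x := (g.restrictScalars k).map_smul c x
          rw [this]; rfl }
    obtain ⟨h, hh⟩ := LinearMap.dualMap_surjective_of_injective (f := f.restrictScalars k) hf gi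
    exact ⟨h, fun x => congrArg (fun φ => φ x) hh⟩
  choose h hh using key
  refine ⟨{ toFun := fun y => Dk.of t
              { toFun := fun p => ∑ i, h i (t.symm (MulOpposite.op (p i)) • y)
                map_add' := ?_
                map_smul' := ?_ }
            map_add' := ?_
            map_smul' := ?_ }, ?_⟩
  · intro p q
    simp [add_smul, Finset.sum_add_distrib]
  · intro c p
    simp [Finset.mul_sum]
  · intro x y
    ext p
    simp [Finset.sum_add_distrib]
  · intro b y
    ext p
    simp [mul_smul]
  · intro x
    ext p
    have : ∀ i, h i (t.symm (MulOpposite.op (p i)) • f x) = (g x).fn (Pi.single i (p i)) := by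
      intro i
      rw [← map_smul, hh, map_smul, Dk.fn_smul]
      congr 1
      rw [t.apply_symm_apply, MulOpposite.unop_op, ← Pi.single_smul, smul_eq_mul, mul_one]
    change ∑ i, h i (t.symm (MulOpposite.op (p i)) • f x) = _
    simp only [this]
    rw [← map_sum, Finset.univ_sum_single]

/-- lifting a functional on the dual -/
lemma Dk.bidual [Module.Finite k N] (Φ : Dk t N →ₗ[k] k) : ∃ x : N, ∀ φ : Dk t N, φ.fn x = Φ φ := by
  obtain ⟨x, hx⟩ := (Module.evalEquiv k N).surjective Φ
  exact ⟨x, fun φ => by rw [← hx]; rfl⟩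

lemma Dk.sep {x y : N} (h : ∀ φ : Dk t N, φ.fn x = φ.fn y) : x = y :=
  ((Module.forall_dual_apply_eq_zero_iff k (x - y)) |>.1 (fun φ => by
    rw [map_sub, sub_eq_zero]; exact h φ)) |> sub_eq_zero.1

/-- section from retraction of duals -/
lemma Dk.sect [Module.Finite k N] {P : Type} [AddCommGroup P] [Module k P] [Module S P] [IsScalarTower k S P]
    [Module.Finite k P] (p : P →ₗ[S] N) (ρ : Dk t P →ₗ[B] Dk t N) (hρ : ∀ φ, ρ (Dk.map t p φ) = φ) :
    ∃ σ : N →ₗ[S] P, ∀ x, p (σ x) = x := by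
  have : ∀ x : N, ∃ y : P, ∀ ψ : Dk t P, ψ.fn y = (ρ ψ).fn x := by
    intro x
    exact Dk.bidual (t := t) (N := P)
      { toFun := fun ψ => (ρ ψ).fn x
        map_add' := by simp
        map_smul' := by
          intro c ψ
          have : ρ (c • ψ) = c • ρ ψ := (ρ.restrictScalars k).map_smul c ψ
          rw [this]; rfl }
  choose σ hσ using this
  refine ⟨{ toFun := σ, map_add' := ?_, map_smul' := ?_ }, ?_⟩
  · intro x y
    apply Dk.sep (t := t)
    intro φ
    simp [hσ]
  · intro s x
    apply Dk.sep (t := t)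
    intro φ
    obtain ⟨b, hb⟩ := t.surjective (MulOpposite.op s)
    have h1 := hσ x (b • φ)
    rw [map_smul, Dk.fn_smul, Dk.fn_smul, hb, MulOpposite.unop_op, ← hσ] at h1
    exact h1.symm
  · intro x
    apply Dk.sep (t := t)
    intro φ
    have := hσ x (Dk.map t p φ)
    rw [hρ] at this
    exact this
end Dual
end


section
open CategoryTheory CategoryTheory.Limits CategoryTheory.Pretriangulated

section Perf
open DerivedCategory

lemma free_ind {R : Type} [Ring R] (Q : ModuleCat.{0} R → Prop)
    (h0 : ∀ Z, IsZero Z → Q Z) (hext : ∀ T : ShortComplex (ModuleCat.{0} R), T.ShortExact → Q T.X₁ → Q T.X₃ → Q T.X₂)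
    (h1 : Q (ModuleCat.of R R)) (r : ℕ) : Q (ModuleCat.of R (Fin r → R)) := by
  induction r with
  | zero => exact h0 _ (ModuleCat.isZero_of_subsingleton _)
  | succ r ih =>
    let f : R →ₗ[R] (Fin (r + 1) → R) := LinearMap.single R (fun _ => R) 0
    let g : (Fin (r + 1) → R) →ₗ[R] (Fin r → R) := LinearMap.funLeft R R Fin.succ
    have hfg : g ∘ₗ f = 0 := by
      ext i
      simp [f, g, LinearMap.funLeft_apply]
    let T : ShortComplex (ModuleCat.{0} R) := ShortComplex.mk (ModuleCat.ofHom f) (ModuleCat.ofHom g)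
      (by rw [← ModuleCat.ofHom_comp, hfg]; rfl)
    refine hext T ?_ h1 ih
    refine { exact := ?_, mono_f := ?_, epi_g := ?_ }
    · rw [ShortComplex.moduleCat_exact_iff]
      intro x hx
      refine ⟨x 0, ?_⟩
      change Pi.single 0 (x 0) = x
      have hx' : ∀ i : Fin r, x i.succ = 0 := fun i => congrFun hx i
      funext i
      refine Fin.cases ?_ (fun i => ?_) i
      · simp
      · rw [hx' i]; simp
    · exact (ModuleCat.mono_iff_injective _).2 (Pi.single_injective (M := fun _ => R) 0)
    · exact (ModuleCat.epi_iff_surjective _).2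
        (LinearMap.funLeft_surjective_of_injective R R _ (Fin.succ_injective r))

variable {R : Type} [Ring R]

lemma injdim_free (n : ℕ) (h : HasInjectiveDimensionLT (ModuleCat.of R R) n) (r : ℕ) :
    HasInjectiveDimensionLT (ModuleCat.of R (Fin r → R)) n := by
  refine free_ind (fun N => HasInjectiveDimensionLT N n) ?_ ?_ h r
  · intro Z hZ
    have := hZ.hasInjectiveDimensionLT_zero
    exact hasInjectiveDimensionLT_of_ge _ 0 n (by omega)
  · intro T hT h1 h3
    exact hT.hasInjectiveDimensionLT_X₂ n h1 h3

variable [HasDerivedCategory.{1} (ModuleCat.{0} R)]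

lemma thick_free (r : ℕ) : thick (UU R) ((singleFunctor (ModuleCat.{0} R) 0).obj (ModuleCat.of R (Fin r → R))) := by
  refine free_ind (fun N => thick (UU R) ((singleFunctor (ModuleCat.{0} R) 0).obj N)) ?_ ?_ (thick_self _) r
  · intro Z hZ
    exact (isThick_thick (UU R)).zero' (thick_self _) _ ((singleFunctor (ModuleCat.{0} R) 0).map_isZero hZ)
  · intro T hT h1 h3
    exact (isThick_thick (UU R)).ext _ hT.singleTriangle_distinguished h1 h3

variable {k B S : Type} [Field k] [Ring B] [Ring S] [Algebra k B] [Algebra k S]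

lemma Dk_free_injective (t : B ≃ₐ[k] Sᵐᵒᵖ) (r : ℕ) : Injective (ModuleCat.of B (Dk t (Fin r → S))) := by
  constructor
  intro X Y g f hf
  obtain ⟨h, hh⟩ := Dk.injective_free (t := t) r f.hom ((ModuleCat.mono_iff_injective _).1 hf) g.hom
  refine ⟨ModuleCat.ofHom h, ?_⟩
  ext x
  exact hh x

lemma perf_of_injdim [HasDerivedCategory.{1} (ModuleCat.{0} S)] [Module.Finite k S] (t : B ≃ₐ[k] Sᵐᵒᵖ) (n : ℕ) :
    ∀ (N : Type) [AddCommGroup N] [Module k N] [Module S N] [IsScalarTower k S N] [Module.Finite k N],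
    HasInjectiveDimensionLT (ModuleCat.of B (Dk t N)) (n + 1) →
    thick (UU S) ((singleFunctor (ModuleCat.{0} S) 0).obj (ModuleCat.of S N)) := by
  induction n with
  | zero =>
    intro N _ _ _ _ _ hN
    have hI : Injective (ModuleCat.of B (Dk t N)) := injective_iff_hasInjectiveDimensionLT_one.2 hN
    have : Module.Finite S N := Module.Finite.of_restrictScalars_finite k S N
    obtain ⟨r, p, hp⟩ := Module.Finite.exists_fin' S N
    have hm : Mono (ModuleCat.ofHom (Dk.map t p)) := (ModuleCat.mono_iff_injective _).2 (Dk.map_inj p hp)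
    obtain ⟨ρ, hρ⟩ := hI.factors (𝟙 _) (ModuleCat.ofHom (Dk.map t p))
    obtain ⟨σ, hσ⟩ := Dk.sect p ρ.hom (fun φ => congrArg (fun f => f.hom φ) hρ)
    refine (isThick_thick (UU S)).ret _ _ ?_ (thick_free r)
    have hr : ModuleCat.ofHom σ ≫ ModuleCat.ofHom p = 𝟙 _ := by
      ext x
      exact hσ x
    exact (Retract.mk (ModuleCat.ofHom σ) (ModuleCat.ofHom p) hr).map _
  | succ n ih =>
    intro N _ _ _ _ _ hN
    have : Module.Finite S N := Module.Finite.of_restrictScalars_finite k S N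
    obtain ⟨r, p, hp⟩ := Module.Finite.exists_fin' S N
    let K := LinearMap.ker p
    have hKf : Module.Finite k K :=
      inferInstanceAs (Module.Finite k (K.restrictScalars k))
    have hex : Function.Exact K.subtype p := LinearMap.exact_subtype_ker_map p
    let T : ShortComplex (ModuleCat.{0} S) := ShortComplex.mk (ModuleCat.ofHom K.subtype) (ModuleCat.ofHom p)
      (by ext x; exact x.2)
    have hT : T.ShortExact :=
      { exact := by
          rw [ShortComplex.moduleCat_exact_iff]
          intro x hx
          exact (hex x).1 hx
        mono_f := (ModuleCat.mono_iff_injective _).2 K.subtype_injective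
        epi_g := (ModuleCat.epi_iff_surjective _).2 hp }
    let T' : ShortComplex (ModuleCat.{0} B) := ShortComplex.mk (ModuleCat.ofHom (Dk.map t p))
      (ModuleCat.ofHom (Dk.map t K.subtype))
      (by ext φ; exact (Dk.exact K.subtype p hp hex).apply_apply_eq_zero φ)
    have hT' : T'.ShortExact :=
      { exact := by
          rw [ShortComplex.moduleCat_exact_iff]
          intro x hx
          exact (Dk.exact K.subtype p hp hex x).1 hx
        mono_f := (ModuleCat.mono_iff_injective _).2 (Dk.map_inj p hp)
        epi_g := (ModuleCat.epi_iff_surjective _).2 (Dk.map_surj _ K.subtype_injective) }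
    have hK : HasInjectiveDimensionLT (ModuleCat.of B (Dk t K)) (n + 1) :=
      hT'.hasInjectiveDimensionLT_X₃ (n + 1)
        (by have := injective_iff_hasInjectiveDimensionLT_one.1 (Dk_free_injective t r)
            exact hasInjectiveDimensionLT_of_ge _ 1 (n + 1) (by omega)) hN
    exact (isThick_thick (UU S)).ext₃ _ hT.singleTriangle_distinguished (ih K hK) (thick_free r)

/-- biduality -/
lemma bidual_injdim (t : B ≃ₐ[k] Sᵐᵒᵖ) (t' : S ≃ₐ[k] Bᵐᵒᵖ) (htt : ∀ b : B, (t' (t b).unop).unop = b)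
    (F : Type) [AddCommGroup F] [Module k F] [Module B F] [IsScalarTower k B F] [Module.Finite k F]
    (n : ℕ) (h : HasInjectiveDimensionLT (ModuleCat.of B F) n) :
    HasInjectiveDimensionLT (ModuleCat.of B (Dk t (Dk t' F))) n := by
  let e0 : F →ₗ[B] Dk t (Dk t' F) :=
    { toFun := fun x => Dk.of t
        { toFun := fun φ => φ.fn x, map_add' := by simp, map_smul' := by simp }
      map_add' := by intro x y; refine Dk.ext fun φ => ?_; exact map_add (Dk.fn φ) x y
      map_smul' := by
        intro b x
        refine Dk.ext fun φ => ?_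
        change Dk.fn φ (b • x) = Dk.fn φ ((t' (t b).unop).unop • x)
        rw [htt] }
  have he : Function.Bijective e0 := by
    constructor
    · intro x y hxy
      exact Dk.sep (t := t') fun φ => congrArg (fun Φ => Dk.fn Φ φ) hxy
    · intro Φ
      obtain ⟨x, hx⟩ := Dk.bidual (t := t') (N := F) Φ.fn
      refine ⟨x, ?_⟩
      ext φ
      exact hx φ
  exact hasInjectiveDimensionLT_of_iso (LinearEquiv.ofBijective e0 he).toModuleIso n

lemma enoughPerfInj [HasDerivedCategory.{1} (ModuleCat.{0} S)] [Module.Finite k S] [Module.Finite k B] (t : B ≃ₐ[k] Sᵐᵒᵖ) (t' : S ≃ₐ[k] Bᵐᵒᵖ)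
    (htt : ∀ b : B, (t' (t b).unop).unop = b) (htt' : ∀ s : S, (t (t' s).unop).unop = s)
    (n : ℕ) (h : HasInjectiveDimensionLT (ModuleCat.of B B) (n + 1)) : EnoughPerfInj S := by
  intro N hN
  let : Module k N := Module.compHom N (algebraMap k S)
  have : IsScalarTower k S N := ⟨fun c b x => by
    rw [Algebra.smul_def, mul_smul]; rfl⟩
  have hNk : Module.Finite k N := Module.Finite.trans S N
  have : Module.Finite B (Dk t N) := Module.Finite.of_restrictScalars_finite k B _
  obtain ⟨r, p, hp⟩ := Module.Finite.exists_fin' B (Dk t N)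
  refine ⟨ModuleCat.of S (Dk t' (Fin r → B)), Dk_free_injective t' r,
    perf_of_injdim t n _ ?_, ?_⟩
  · have hB := injdim_free (n + 1) h r
    exact bidual_injdim t t' htt _ (n + 1) hB
  · let f : N →ₗ[S] Dk t' (Fin r → B) :=
      { toFun := fun x => Dk.of t'
          { toFun := fun q => (p q).fn x
            map_add' := by simp
            map_smul' := by
              intro c q
              have : p (c • q) = c • p q := (p.restrictScalars k).map_smul c q
              rw [this]; rfl }
        map_add' := by intro x y; ext q; simp
        map_smul' := by intro s x; ext q; simp [htt'] }
    refine ⟨ModuleCat.ofHom f, (ModuleCat.mono_iff_injective _).2 ?_⟩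
    intro x y hxy
    apply Dk.sep (t := t)
    intro φ
    obtain ⟨q, rfl⟩ := hp φ
    exact congrArg (fun Φ : Dk t' (Fin r → B) => Dk.fn Φ q) hxy
end Perf
end


section
open CategoryTheory CategoryTheory.Limits CategoryTheory.Pretriangulated

lemma triMat_finite (k B C M : Type) [Field k] [Ring B] [Ring C] [Algebra k B] [Algebra k C]
    [AddCommGroup M] [Module C M] [Module Bᵐᵒᵖ M] [SMulCommClass C Bᵐᵒᵖ M]
    [Module k M] [IsScalarTower k C M] [IsScalarTower k Bᵐᵒᵖ M]
    [FiniteDimensional k B] [FiniteDimensional k C] [FiniteDimensional k M] :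
    Module.Finite k (TriMat B C M) := by
  let f : (B × M × C) →ₗ[k] TriMat B C M :=
    { toFun := fun x => ⟨x.1, x.2.1, x.2.2⟩
      map_add' := fun x y => rfl
      map_smul' := fun c x => by
        rw [RingHom.id_apply, Algebra.smul_def]
        change _ = TriMat.algMap B C M k c * _
        ext
        · simp [TriMat.algMap, Algebra.smul_def]
        · simp [TriMat.algMap]
        · simp [TriMat.algMap, Algebra.smul_def] }
  exact Module.Finite.of_surjective f fun x => ⟨(x.fst, x.mid, x.snd), rfl⟩

lemma injdim_op (R : Type) [Ring R] (n : ℕ)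
    (h : HasInjectiveDimensionLT (ModuleCat.of Rᵐᵒᵖ R) n) :
    HasInjectiveDimensionLT (ModuleCat.of Rᵐᵒᵖ Rᵐᵒᵖ) n := by
  let e : R ≃ₗ[Rᵐᵒᵖ] Rᵐᵒᵖ :=
    { MulOpposite.opAddEquiv with
      map_smul' := fun r x => rfl }
  exact hasInjectiveDimensionLT_of_iso e.toModuleIso n

section
open scoped ModuleCat.Algebra
lemma final_thick (k : Type) [Field k] {A B C : Type} [Ring A] [Ring B] [Ring C]
    [Algebra k A] [Algebra k B] [Module.Finite k A] [Module.Finite k B]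
    [HasDerivedCategory.{1} (ModuleCat.{0} A)] [HasDerivedCategory.{1} (ModuleCat.{0} B)]
    [HasDerivedCategory.{1} (ModuleCat.{0} C)]
    {iS : DMod A ⥤ DMod B} {iP : DMod B ⥤ DMod A} {iH : DMod A ⥤ DMod B}
    {jL : DMod C ⥤ DMod A} {jS : DMod A ⥤ DMod C} {jR : DMod C ⥤ DMod A}
    (tS : IsTriangleFunctor iS) (tP : IsTriangleFunctor iP) (tH : IsTriangleFunctor iH)
    (tjL : IsTriangleFunctor jL) (tjS : IsTriangleFunctor jS)
    (hrec : IsRecollement iS iP iH jL jS jR) (n : ℕ)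
    (hA : HasInjectiveDimensionLT (ModuleCat.of A A) (n + 1)) (hB : EnoughPerfInj B) :
    thick (UU B) (iH.obj (UU A)) := by
  have hfin := iB_fin k tS tP tjL tjS hrec
  obtain ⟨a1, a2, -, -, hf, -⟩ := hrec
  have hUU : Module.Finite k (UU B ⟶ UU B) := by
    have := finH_iff.1 (fin_UU (R := B) k) 0
    exact Module.Finite.equiv (Linear.homCongr k (Iso.refl (UU B))
      ((shiftFunctorZero (DMod B) ℤ).app (UU B)))
  obtain ⟨c, hc⟩ := X_GE tS tP tH a1 a2
  obtain ⟨L, hL⟩ := X_injdim tS tP a1 a2 n hA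
  exact coghost_final (k := k) hB _ c hc
    (finH_iff.2 fun m => fin_of_fgh (X_fgh k tP tH a2 hf hfin m) hUU) L hL
end
end

/-- For Gorenstein finite-dimensional algebras `B`, `C` over `k` and a `C`-`B`-bimodule `M`
with `A = [[B,0],[M,C]]` Gorenstein, the functor `i^!` of any recollement
`(D(Mod B), D(Mod A), D(Mod C))` preserves compact objects, i.e. it maps
`K^b(proj A)` into `K^b(proj B)`. -/
theorem iShriek_preserves_compacts_of_gorenstein_triangular_matrix
    (k B C M : Type) [Field k] [Ring B] [Ring C] [Algebra k B] [Algebra k C]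
    [AddCommGroup M] [Module C M] [Module Bᵐᵒᵖ M] [SMulCommClass C Bᵐᵒᵖ M]
    [Module k M] [IsScalarTower k C M] [IsScalarTower k Bᵐᵒᵖ M]
    [FiniteDimensional k B] [FiniteDimensional k C] [FiniteDimensional k M]
    (hB : IsGorenstein B) (hC : IsGorenstein C) (hA : IsGorenstein (TriMat B C M))
    [HasDerivedCategory.{1} (ModuleCat.{0} Bᵐᵒᵖ)]
    [HasDerivedCategory.{1} (ModuleCat.{0} Cᵐᵒᵖ)]
    [HasDerivedCategory.{1} (ModuleCat.{0} (TriMat B C M)ᵐᵒᵖ)]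
    (iStar : DerivedCategory (ModuleCat.{0} (TriMat B C M)ᵐᵒᵖ) ⥤
      DerivedCategory (ModuleCat.{0} Bᵐᵒᵖ))
    (iPush : DerivedCategory (ModuleCat.{0} Bᵐᵒᵖ) ⥤
      DerivedCategory (ModuleCat.{0} (TriMat B C M)ᵐᵒᵖ))
    (iShriek : DerivedCategory (ModuleCat.{0} (TriMat B C M)ᵐᵒᵖ) ⥤
      DerivedCategory (ModuleCat.{0} Bᵐᵒᵖ))
    (jShriek : DerivedCategory (ModuleCat.{0} Cᵐᵒᵖ) ⥤
      DerivedCategory (ModuleCat.{0} (TriMat B C M)ᵐᵒᵖ))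
    (jStar : DerivedCategory (ModuleCat.{0} (TriMat B C M)ᵐᵒᵖ) ⥤
      DerivedCategory (ModuleCat.{0} Cᵐᵒᵖ))
    (jPush : DerivedCategory (ModuleCat.{0} Cᵐᵒᵖ) ⥤
      DerivedCategory (ModuleCat.{0} (TriMat B C M)ᵐᵒᵖ))
    (tiStar : IsTriangleFunctor iStar) (tiPush : IsTriangleFunctor iPush)
    (tiShriek : IsTriangleFunctor iShriek) (tjShriek : IsTriangleFunctor jShriek)
    (tjStar : IsTriangleFunctor jStar) (tjPush : IsTriangleFunctor jPush)
    (hrec : IsRecollement iStar iPush iShriek jShriek jStar jPush) :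
    Set.MapsTo iShriek.obj (KbProjSet ((TriMat B C M)ᵐᵒᵖ)) (KbProjSet Bᵐᵒᵖ) := by
  have := triMat_finite k B C M
  have : Module.Finite k (TriMat B C M)ᵐᵒᵖ :=
    Module.Finite.equiv (MulOpposite.opLinearEquiv k)
  have : Module.Finite k Bᵐᵒᵖ := Module.Finite.equiv (MulOpposite.opLinearEquiv k)
  obtain ⟨n, hn⟩ := hA.2
  obtain ⟨m, hm⟩ := hB.1
  have hA' := injdim_op _ _ (hasInjDim_of_injDimLE hn)
  have hB' : EnoughPerfInj Bᵐᵒᵖ :=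
    enoughPerfInj (k := k) (AlgEquiv.opOp k B) (AlgEquiv.refl (R := k) (A₁ := Bᵐᵒᵖ))
      (fun b => rfl) (fun s => rfl) m (hasInjDim_of_injDimLE hm)
  have key := final_thick k tiStar tiPush tiShriek tjShriek tjStar hrec n hA' hB'
  intro P hP
  have h1 : thick (UU _) P := thick_UU_of_cpt (Cpt.lower (cpt_of_isCompactObj hP))
  exact isCompactObj_of_cpt (cpt1_of_thick
    (thick_induction (IsThick.comap iShriek tiShriek (isThick_thick _)) key h1))
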